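/- Suppose γ > 0, 1 < q < ∞, α > −1, and 0 < p < ∞. For a holomorphic function f on 𝔹_n, the following are equivalent: (a) f ∈ A^p_α; (b) A_γ^{(q)}(Rf) ∈ L^p(𝔹_n, dv_α); (c) A_γ^{(q)}(∇f) ∈ L^p(𝔹_n, dv_α); (d) A_γ^{(q)}(∇̃f) ∈ L^p(𝔹_n, dv_α). Moreover, each of the quantities |f(0)| + ‖A_γ^{(q)}(Rf)‖_{L^p(dv_α)}, |f(0)| + ‖A_γ^{(q)}(∇f)‖_{L^p(dv_α)}, and |f(0)| + ‖A_γ^{(q)}(∇̃f)‖_{L^p(dv_α)} is comparable to ‖f‖_{p,α}, with comparison constants depending only on γ, q, α, p, n. -/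

import Mathlib

open MeasureTheory Filter Topology
open scoped Classical ENNReal

noncomputable section

/-- `ℂⁿ` with the Euclidean norm. -/
abbrev En (n : ℕ) := EuclideanSpace ℂ (Fin n)

instance (n : ℕ) : MeasurableSpace (En n) := borel _
instance (n : ℕ) : BorelSpace (En n) := ⟨rfl⟩

/-- The Lebesgue volume measure on `ℂⁿ`. -/
def vol (n : ℕ) : Measure (En n) := Measure.addHaar

/-- The open unit ball `𝔹ₙ` of `ℂⁿ`. -/
def uball (n : ℕ) : Set (En n) := Metric.ball 0 1

/-- The Hermitian pairing `⟨z,w⟩ = ∑ⱼ zⱼ * conj wⱼ`. -/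
def herm {n : ℕ} (z w : En n) : ℂ := ∑ j, z j * (starRingEnd ℂ) (w j)

/-- The orthogonal projection `P_z w` onto the line spanned by `z`. -/
def prj {n : ℕ} (z w : En n) : En n :=
  if z = 0 then 0 else (herm w z / herm z z) • z

/-- The Möbius automorphism `φ_z` of the unit ball. -/
def mobius {n : ℕ} (z w : En n) : En n :=
  ((1 : ℂ) / (1 - herm w z)) •
    (z - prj z w - ((Real.sqrt (1 - ‖z‖ ^ 2) : ℝ) : ℂ) • (w - prj z w))

/-- The Bergman metric `β(z,w)`. -/
def bmet {n : ℕ} (z w : En n) : ℝ :=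
  (1 / 2) * Real.log ((1 + ‖mobius z w‖) / (1 - ‖mobius z w‖))

/-- The Bergman metric ball `D(z,γ)`. -/
def Dball {n : ℕ} (z : En n) (γ : ℝ) : Set (En n) :=
  {w | w ∈ uball n ∧ bmet z w < γ}

/-- The normalizing constant `c_α`. -/
def cnorm (n : ℕ) (α : ℝ) : ℝ :=
  if -1 < α then Real.Gamma (n + α + 1) / (n.factorial * Real.Gamma (α + 1)) else 1

/-- The weighted measure `dv_α = c_α (1-|z|²)^α dv` on the unit ball. -/
def measA (n : ℕ) (α : ℝ) : Measure (En n) :=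
  ((vol n).restrict (uball n)).withDensity
    (fun z => ENNReal.ofReal (cnorm n α * (1 - ‖z‖ ^ 2) ^ α))

/-- The invariant measure `dτ = (1-|z|²)^{-(n+1)} dv` on the unit ball. -/
def measTau (n : ℕ) : Measure (En n) :=
  ((vol n).restrict (uball n)).withDensity
    (fun z => ENNReal.ofReal ((1 - ‖z‖ ^ 2) ^ (-((n : ℝ) + 1))))

/-- The Bergman space (quasi-)norm `‖f‖_{p,α}`, valued in `ℝ≥0∞`. -/
def apnorm (n : ℕ) (p α : ℝ) (f : En n → ℂ) : ℝ≥0∞ :=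
  (∫⁻ z, ENNReal.ofReal (‖f z‖ ^ p) ∂measA n α) ^ (1 / p)

/-- The radial derivative `Rf(z) = ∑ z_k ∂f/∂z_k = Df(z)[z]`. -/
def radD {n : ℕ} (f : En n → ℂ) (z : En n) : ℂ := fderiv ℂ f z z

/-- Iterated radial derivative `R^k f`. -/
def radIter {n : ℕ} : ℕ → (En n → ℂ) → En n → ℂ
  | 0, f => f
  | (k + 1), f => radD (radIter k f)

/-- The pseudo-metric `ϱ` on the unit ball. -/
def rho {n : ℕ} (z w : En n) : ℝ :=
  if z ≠ 0 ∧ w ≠ 0 then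
    |‖z‖ - ‖w‖| + ‖1 - herm z w / ((‖z‖ : ℂ) * (‖w‖ : ℂ))‖
  else ‖z‖ + ‖w‖

/-- The area integral `A_γ^{(q)} g(z) = (∫_{D(z,γ)} g(w)^q dτ(w))^{1/q}`, valued in `ℝ≥0∞`. -/
def areaF {n : ℕ} (γ q : ℝ) (g : En n → ℝ) (z : En n) : ℝ≥0∞ :=
  (∫⁻ w in Dball z γ, ENNReal.ofReal (g w) ^ q ∂measTau n) ^ (1 / q)

/-- `|(1-|w|²) Rf(w)|`. -/
def radArea {n : ℕ} (f : En n → ℂ) (w : En n) : ℝ := (1 - ‖w‖ ^ 2) * ‖radD f w‖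

/-- `|(1-|w|²) ∇f(w)|`, where `|∇f(w)|` is the Euclidean norm of the complex gradient. -/
def gradArea {n : ℕ} (f : En n → ℂ) (w : En n) : ℝ := (1 - ‖w‖ ^ 2) * ‖fderiv ℂ f w‖

/-- `|∇̃f(w)| = |∇(f ∘ φ_w)(0)|`, the invariant gradient. -/
def invGradArea {n : ℕ} (f : En n → ℂ) (w : En n) : ℝ := ‖fderiv ℂ (f ∘ mobius w) 0‖


/-- tangent inequality -/
lemma aux_tangent {p x c : ℝ} (hx : 0 < x) (hc : 0 < c) :
    c ^ p * (1 + p * (Real.log x - Real.log c)) ≤ x ^ p := by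
  have h1 : x ^ p = c ^ p * Real.exp (p * (Real.log x - Real.log c)) := by
    rw [Real.rpow_def_of_pos hx, Real.rpow_def_of_pos hc, ← Real.exp_add]
    ring_nf
  rw [h1]
  have := Real.add_one_le_exp (p * (Real.log x - Real.log c))
  have h2 : 0 < c ^ p := Real.rpow_pos_of_pos hc p
  nlinarith

lemma aux_jensen {h : ℂ → ℂ} {R : ℝ} (hR : 1 < R) (hh : DifferentiableOn ℂ h (Metric.ball 0 R))
    (h0 : h 0 ≠ 0) : Real.log ‖h 0‖ ≤ Real.circleAverage (fun z => Real.log ‖h z‖) 0 1 := by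
  have han : AnalyticOnNhd ℂ h (Metric.closedBall 0 |(1:ℝ)|) := by
    intro z hz
    refine hh.analyticAt (Metric.isOpen_ball.mem_nhds ?_)
    simp at hz ⊢; linarith
  rw [han.circleAverage_log_norm one_ne_zero h0]
  have : 0 ≤ ∑ᶠ u, (MeromorphicOn.divisor h (Metric.closedBall 0 |(1:ℝ)|) u : ℝ)
      * Real.log (1 * ‖0 - u‖⁻¹) := by
    apply finsum_nonneg
    intro u
    by_cases hu : u ∈ Metric.closedBall (0:ℂ) |(1:ℝ)|
    · apply mul_nonneg
      · exact_mod_cast MeromorphicOn.AnalyticOnNhd.divisor_nonneg han u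
      · by_cases hu0 : u = 0
        · simp [hu0]
        apply Real.log_nonneg
        simp only [zero_sub, norm_neg, one_mul]
        simp at hu
        exact (one_le_inv₀ (norm_pos_iff.2 hu0)).2 hu
    · rw [Function.locallyFinsuppWithin.apply_eq_zero_of_notMem _ hu]; simp
  linarith

lemma aux_submean1 {h : ℂ → ℂ} {R p : ℝ} (hR : 1 < R) (hp : 0 < p)
    (hh : DifferentiableOn ℂ h (Metric.ball 0 R)) :
    ENNReal.ofReal (2 * Real.pi) * ENNReal.ofReal (‖h 0‖ ^ p) ≤
      ∫⁻ θ in Set.Ioc 0 (2 * Real.pi), ENNReal.ofReal (‖h (circleMap 0 1 θ)‖ ^ p) := by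
  by_cases h0 : h 0 = 0
  · simp [h0, Real.zero_rpow hp.ne']
  have hJ := aux_jensen hR hh h0
  have han : AnalyticOnNhd ℂ h (Metric.closedBall 0 |(1:ℝ)|) := by
    intro z hz
    refine hh.analyticAt (Metric.isOpen_ball.mem_nhds ?_)
    simp at hz ⊢; linarith
  have hmem : ∀ θ : ℝ, circleMap 0 1 θ ∈ Metric.ball (0:ℂ) R := by
    intro θ; simp [circleMap]; linarith
  have hci : CircleIntegrable (fun z => Real.log ‖h z‖) 0 1 :=
    ((han.mono Metric.sphere_subset_closedBall).meromorphicOn).circleIntegrable_log_norm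
  have hcont : Continuous (fun θ : ℝ => ‖h (circleMap 0 1 θ)‖ ^ p) := by
    refine Continuous.rpow_const (Continuous.norm ?_) (fun _ => Or.inr hp.le)
    exact hh.continuousOn.comp_continuous (continuous_circleMap 0 1) hmem
  have hπ : 0 < 2 * Real.pi := by positivity
  -- zero set is null
  have hae : ∀ᵐ θ ∂(volume.restrict (Set.Ioc 0 (2 * Real.pi))), h (circleMap 0 1 θ) ≠ 0 := by
    have hcod : ∀ᶠ z in codiscreteWithin (Metric.closedBall (0:ℂ) |(1:ℝ)|), h z ≠ 0 := by
      have := han.preimage_zero_mem_codiscreteWithin (x := 0) h0 (by simp)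
        (by exact ((convex_closedBall (0:ℂ) |(1:ℝ)|).isConnected (by simp)))
      filter_upwards [this] with z hz
      simpa using hz
    have h2 := Filter.codiscreteWithin_mono (Metric.sphere_subset_closedBall) hcod
    have h3 := circleMap_preimage_codiscrete (c := 0) (R := 1) one_ne_zero h2
    exact ae_restrict_le_codiscreteWithin measurableSet_Ioc
      (codiscreteWithin_mono (by tauto) h3)
  have hint1 : IntegrableOn (fun θ => ‖h (circleMap 0 1 θ)‖ ^ p) (Set.Ioc 0 (2 * Real.pi)) :=
    (hcont.intervalIntegrable 0 (2*Real.pi)).1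
  have hint2 : IntegrableOn (fun θ => Real.log ‖h (circleMap 0 1 θ)‖) (Set.Ioc 0 (2 * Real.pi)) := by
    have := hci
    exact this.1
  have hpos : 0 < ‖h 0‖ := norm_pos_iff.2 h0
  have key : (2 * Real.pi) * ‖h 0‖ ^ p ≤ ∫ θ in Set.Ioc 0 (2 * Real.pi), ‖h (circleMap 0 1 θ)‖ ^ p := by
    have e1 : ∫ θ in Set.Ioc 0 (2 * Real.pi), (‖h 0‖ ^ p * (1 - p * Real.log ‖h 0‖) +
        (‖h 0‖ ^ p * p) * Real.log ‖h (circleMap 0 1 θ)‖) ≤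
        ∫ θ in Set.Ioc 0 (2 * Real.pi), ‖h (circleMap 0 1 θ)‖ ^ p := by
      apply integral_mono_ae
      · exact (integrable_const _).add (hint2.const_mul _)
      · exact hint1
      · filter_upwards [hae] with θ hθ
        have := aux_tangent (p := p) (norm_pos_iff.2 hθ) hpos
        linarith
    refine le_trans ?_ e1
    rw [integral_add (integrable_const _) (hint2.const_mul _)]
    have h8 : ∫ θ in Set.Ioc 0 (2 * Real.pi), (‖h 0‖ ^ p * p) * Real.log ‖h (circleMap 0 1 θ)‖ =
      (‖h 0‖ ^ p * p) * ∫ θ in Set.Ioc 0 (2 * Real.pi), Real.log ‖h (circleMap 0 1 θ)‖ :=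
      integral_const_mul _ _
    rw [h8, setIntegral_const]
    rw [Real.circleAverage_def, intervalIntegral.integral_of_le hπ.le] at hJ
    simp only [smul_eq_mul] at hJ
    have h5 : (2 * Real.pi) * Real.log ‖h 0‖ ≤ ∫ θ in Set.Ioc 0 (2 * Real.pi), Real.log ‖h (circleMap 0 1 θ)‖ := by
      rw [inv_mul_eq_div, le_div_iff₀ hπ] at hJ
      linarith
    have h6 : 0 < ‖h 0‖ ^ p * p := mul_pos (Real.rpow_pos_of_pos hpos p) hp
    have h7 := mul_le_mul_of_nonneg_left h5 h6.le
    simp only [Real.volume_real_Ioc_of_le hπ.le, smul_eq_mul, sub_zero]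
    linarith
  rw [← ofReal_integral_eq_lintegral_ofReal hint1 (ae_of_all _ fun _ => by positivity),
    ← ENNReal.ofReal_mul hπ.le]
  exact ENNReal.ofReal_le_ofReal key


lemma aux_fderiv_line {E : Type*} [NormedAddCommGroup E] [NormedSpace ℂ E] 
    {f : E → ℂ} {U : Set E} (hU : IsOpen U) (hf : DifferentiableOn ℂ f U) {z : E} (hz : z ∈ U)
    (x v : E) : DifferentiableAt ℂ (fun l : ℂ => fderiv ℂ f (z + l • x) v) 0 := by
  have hcz : ContinuousAt f z := hf.continuousOn.continuousAt (hU.mem_nhds hz)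
  obtain ⟨ε, hε, hball⟩ : ∃ ε > 0, ∀ y, dist y z < ε → y ∈ U ∧ ‖f y‖ ≤ ‖f z‖ + 1 := by
    have h1 : ∀ᶠ y in 𝓝 z, ‖f y‖ < ‖f z‖ + 1 :=
      hcz.norm.eventually_lt_const (by linarith)
    have h2 : ∀ᶠ y in 𝓝 z, y ∈ U := hU.mem_nhds hz
    obtain ⟨ε, hε, h⟩ := Metric.eventually_nhds_iff.1 (h1.and h2)
    exact ⟨ε, hε, fun y hy => ⟨(h hy).2, (h hy).1.le⟩⟩
  set M := ‖f z‖ + 1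
  have hM : 0 ≤ M := by positivity
  set r : ℝ := ε / (2 * (2 * ‖x‖ + ‖v‖ + 1)) with hr
  have hr0 : 0 < r := by positivity
  have hrε : 2 * r * ‖x‖ + r * ‖v‖ < ε := by
    have h3 : r * (2 * (2 * ‖x‖ + ‖v‖ + 1)) = ε := by rw [hr]; field_simp
    nlinarith [norm_nonneg x, norm_nonneg v]
  have hin : ∀ l m : ℂ, ‖l‖ ≤ 2 * r → ‖m‖ ≤ r → dist (z + l • x + m • v) z < ε := by
    intro l m hl hm
    rw [dist_eq_norm, show z + l • x + m • v - z = l • x + m • v by abel]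
    refine lt_of_le_of_lt (norm_add_le _ _) (lt_of_le_of_lt ?_ hrε)
    rw [norm_smul, norm_smul]
    gcongr
  have hdf : ∀ l m : ℂ, ‖l‖ ≤ 2 * r → ‖m‖ ≤ r → DifferentiableAt ℂ f (z + l • x + m • v) :=
    fun l m hl hm => hf.differentiableAt (hU.mem_nhds (hball _ (hin l m hl hm)).1)
  have hcirc : ∀ t : ℝ, ‖circleMap 0 r t‖ ≤ r := by
    intro t; simp [abs_of_pos hr0]
  set co : ℝ → ℂ := fun t => deriv (circleMap 0 r) t * ((circleMap 0 r t - 0) ^ 2)⁻¹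
  have hcoc : Continuous co := by
    refine Continuous.mul ?_ (Continuous.inv₀ (by fun_prop) ?_)
    · rw [show deriv (circleMap 0 r) = fun t => circleMap 0 r t * Complex.I from funext fun t => deriv_circleMap 0 r t]; fun_prop
    · intro t; simp [circleMap, hr0.ne']
  have hcon : ∀ t, ‖co t‖ = 1 / r := by
    intro t
    simp only [co, deriv_circleMap]
    simp [abs_of_pos hr0]; field_simp
  have hdl : ∀ l m : ℂ, ‖l‖ ≤ 2 * r → ‖m‖ ≤ r → HasDerivAt (fun l => f (z + l • x + m • v))
      (fderiv ℂ f (z + l • x + m • v) x) l := by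
    intro l m hl hm
    have h1 : HasDerivAt (fun l : ℂ => z + l • x + m • v) x l := by
      simpa using (((hasDerivAt_id l).smul_const x).const_add z).add_const (m • v)
    exact (hdf l m hl hm).hasFDerivAt.comp_hasDerivAt l h1
  have key := intervalIntegral.hasDerivAt_integral_of_dominated_loc_of_deriv_le (μ := volume)
    (a := 0) (b := 2 * Real.pi) (𝕜 := ℂ) (E := ℂ)
    (F := fun l t => co t * f (z + l • x + circleMap 0 r t • v))
    (F' := fun l t => co t * fderiv ℂ f (z + l • x + circleMap 0 r t • v) x)
    (x₀ := 0) (s := Metric.ball 0 r) (bound := fun _ => (1 / r) * (M / r))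
    (Metric.ball_mem_nhds 0 hr0) ?_ ?_ ?_ ?_ ?_ ?_
  · have hd := key.2.differentiableAt.const_mul ((2 * Real.pi * Complex.I : ℂ)⁻¹)
    refine hd.congr_of_eventuallyEq ?_
    filter_upwards [Metric.ball_mem_nhds (0:ℂ) hr0] with l hl
    have hl' : ‖l‖ < r := by simpa using hl
    have hl2 : ‖l‖ ≤ r := hl'.le
    -- work on slightly larger open set
    have hUo : IsOpen ((fun m : ℂ => z + l • x + m • v) ⁻¹' U) :=
      hU.preimage (by fun_prop)
    have hdm : ∀ m ∈ ((fun m : ℂ => z + l • x + m • v) ⁻¹' U), 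
        HasDerivAt (fun m => f (z + l • x + m • v)) (fderiv ℂ f (z + l • x + m • v) v) m := by
      intro m hm
      have h1 : HasDerivAt (fun m : ℂ => z + l • x + m • v) v m := by
        simpa using (((hasDerivAt_id m).smul_const v).const_add (z + l • x))
      exact (hf.differentiableAt (hU.mem_nhds hm)).hasFDerivAt.comp_hasDerivAt m h1
    have h2 := Complex.two_pi_I_inv_smul_circleIntegral_sub_sq_inv_smul_of_differentiable hUo
      (c := 0) (w₀ := 0) (R := r) (f := fun m => f (z + l • x + m • v)) 
      (by
        intro m hm
        exact (hball _ (hin l m (by linarith) (by simpa using hm))).1)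
      (fun m hm => (hdm m hm).differentiableAt.differentiableWithinAt) (by simpa using hr0)
    have h3 := (hdm 0 (by 
        exact (hball _ (hin l 0 (by linarith) (by simpa using hr0.le))).1)).deriv
    rw [h3] at h2
    simp only [zero_smul, add_zero] at h2
    rw [← h2, circleIntegral]
    simp only [smul_eq_mul, co, mul_assoc]
  · filter_upwards [Metric.ball_mem_nhds (0:ℂ) hr0] with l hl
    have hl' : ‖l‖ < r := by simpa using hl
    refine (Continuous.mul hcoc ?_).aestronglyMeasurable
    refine continuous_iff_continuousAt.2 fun t => ?_
    exact ContinuousAt.comp (f := fun t : ℝ => z + l • x + circleMap 0 r t • v)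
      (hdf l _ (by linarith) (hcirc t)).continuousAt (by fun_prop)
  · refine (Continuous.mul hcoc ?_).intervalIntegrable _ _
    refine continuous_iff_continuousAt.2 fun t => ?_
    exact ContinuousAt.comp (f := fun t : ℝ => z + (0:ℂ) • x + circleMap 0 r t • v)
      (hdf 0 _ (by simp [hr0.le]) (hcirc t)).continuousAt (by fun_prop)
  · refine hcoc.aestronglyMeasurable.mul ?_
    -- limit of difference quotients
    have hlim : ∀ t : ℝ, Tendsto (fun k : ℕ => ((r / (k + 1) : ℝ) : ℂ)⁻¹ * 
        (f (z + ((r / (k + 1) : ℝ) : ℂ) • x + circleMap 0 r t • v) - f (z + (0:ℂ) • x + circleMap 0 r t • v)))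
        atTop (𝓝 (fderiv ℂ f (z + (0:ℂ) • x + circleMap 0 r t • v) x)) := by
      intro t
      have := (hdl 0 _ (by simp [hr0.le]) (hcirc t)).tendsto_slope_zero
      have h0 : Tendsto (fun k : ℕ => ((r / (k + 1) : ℝ) : ℂ)) atTop (𝓝[≠] 0) := by
        apply tendsto_nhdsWithin_iff.2 ⟨?_, ?_⟩
        · have h1 : Tendsto (fun k : ℕ => r / ((k : ℝ) + 1)) atTop (𝓝 0) := by
            simpa [div_eq_mul_inv] using (tendsto_one_div_add_atTop_nhds_zero_nat (𝕜 := ℝ)).const_mul r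
          have h2 := (Complex.continuous_ofReal.tendsto 0).comp h1
          rw [Complex.ofReal_zero] at h2
          exact h2
        · refine Eventually.of_forall fun k => ?_
          have : r / ((k:ℝ) + 1) ≠ 0 := by positivity
          exact Complex.ofReal_ne_zero.2 this
      have := this.comp h0
      simpa [Function.comp_def] using this
    refine aestronglyMeasurable_of_tendsto_ae atTop (fun k => ?_) (ae_of_all _ hlim)
    refine Continuous.aestronglyMeasurable ?_
    have hk : ‖((r / ((k : ℝ) + 1) : ℝ) : ℂ)‖ ≤ 2 * r := by
      rw [Complex.norm_real, Real.norm_of_nonneg (by positivity)]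
      have : r / ((k:ℝ) + 1) ≤ r := div_le_self hr0.le (by linarith [(Nat.cast_nonneg k : (0:ℝ) ≤ k)])
      linarith
    refine continuous_const.mul (Continuous.sub ?_ ?_)
    · refine continuous_iff_continuousAt.2 fun t => ?_
      exact ContinuousAt.comp (f := fun t : ℝ => z + ((r / ((k:ℝ) + 1) : ℝ) : ℂ) • x + circleMap 0 r t • v)
        (hdf _ _ hk (hcirc t)).continuousAt (by fun_prop)
    · refine continuous_iff_continuousAt.2 fun t => ?_
      exact ContinuousAt.comp (f := fun t : ℝ => z + (0:ℂ) • x + circleMap 0 r t • v)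
        (hdf 0 _ (by simp [hr0.le]) (hcirc t)).continuousAt (by fun_prop)
  · refine ae_of_all _ fun t _ l hl => ?_
    have hl' : ‖l‖ < r := by simpa using hl
    rw [norm_mul, hcon]
    gcongr
    have hd := (hdl l _ (by linarith) (hcirc t)).deriv
    rw [← hd]
    have hsub : ∀ m ∈ Metric.closedBall l r, ‖m‖ ≤ 2 * r := by
      intro m hm
      have h1 : ‖m - l‖ ≤ r := by simpa [dist_eq_norm] using hm
      have := norm_le_norm_add_norm_sub' m l
      linarith
    refine Complex.norm_deriv_le_of_forall_mem_sphere_norm_le hr0 ?_ ?_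
    · refine DifferentiableOn.diffContOnCl ?_
      intro m hm
      rw [closure_ball _ hr0.ne'] at hm
      exact (hdl m _ (hsub m hm) (hcirc t)).differentiableAt.differentiableWithinAt
    · intro m hm
      exact (hball _ (hin m _ (hsub m (Metric.sphere_subset_closedBall hm)) (hcirc t))).2
  · simp
  · refine ae_of_all _ fun t _ l hl => ?_
    have hl' : ‖l‖ < r := by simpa using hl
    exact (hdl l _ (by linarith) (hcirc t)).const_mul _

lemma aux_fderiv_line' {E : Type*} [NormedAddCommGroup E] [NormedSpace ℂ E] 
    {f : E → ℂ} {U : Set E} (hU : IsOpen U) (hf : DifferentiableOn ℂ f U) {z x : E} {l : ℂ}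
    (hz : z + l • x ∈ U) (v : E) :
    DifferentiableAt ℂ (fun l : ℂ => fderiv ℂ f (z + l • x) v) l := by
  have h := aux_fderiv_line hU hf hz x v
  have h2 : DifferentiableAt ℂ (fun m : ℂ => fderiv ℂ f (z + l • x + (m - l) • x) v) l := by
    have := DifferentiableAt.comp (x := l) (f := fun m : ℂ => m - l)
      (g := fun l' : ℂ => fderiv ℂ f (z + l • x + l' • x) v) (by simpa using h) (by fun_prop)
    exact this
  refine h2.congr_of_eventuallyEq (Eventually.of_forall fun m => ?_)
  simp only
  congr 2
  rw [sub_smul]; abel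

/-- the radial derivative is holomorphic along lines -/
lemma aux_radD_line {n : ℕ} {f : En n → ℂ} (hf : DifferentiableOn ℂ f (uball n)) {z x : En n} {l : ℂ}
    (hz : z + l • x ∈ uball n) :
    DifferentiableAt ℂ (fun l : ℂ => radD f (z + l • x)) l := by
  have h1 := aux_fderiv_line' Metric.isOpen_ball hf hz z
  have h2 := aux_fderiv_line' Metric.isOpen_ball hf hz x
  have : (fun l : ℂ => radD f (z + l • x)) =
      fun l : ℂ => fderiv ℂ f (z + l • x) z + l * fderiv ℂ f (z + l • x) x := by
    ext l; simp [radD]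
  rw [this]
  exact h1.add (differentiableAt_id.mul h2)


instance instHaarVol (n : ℕ) : (vol n).IsAddHaarMeasure := by unfold vol; infer_instance

lemma aux_map_vol {n : ℕ} (T : En n →ₗ[ℂ] En n) (hT : LinearMap.det T ≠ 0) :
    Measure.map T (vol n) = ENNReal.ofReal ((‖LinearMap.det T‖ ^ 2)⁻¹) • vol n := by
  have h1 : LinearMap.det (T.restrictScalars ℝ) = ‖LinearMap.det T‖ ^ 2 := by
    rw [LinearMap.det_restrictScalars, Algebra.norm_complex_apply, Complex.normSq_eq_norm_sq]
  have h2 : LinearMap.det (T.restrictScalars ℝ) ≠ 0 := by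
    rw [h1]; positivity
  have := Measure.map_linearMap_addHaar_eq_smul_addHaar (vol n) h2
  rw [h1, abs_of_nonneg (by positivity)] at this
  exact this

lemma aux_lintegral_lin {n : ℕ} (T : En n →ₗ[ℂ] En n) (hT : LinearMap.det T ≠ 0) {g : En n → ℝ≥0∞}
    (hg : Measurable g) :
    ∫⁻ x, g (T x) ∂vol n = ENNReal.ofReal ((‖LinearMap.det T‖ ^ 2)⁻¹) * ∫⁻ x, g x ∂vol n := by
  have hTm : Measurable T := (LinearMap.continuous_of_finiteDimensional T).measurable
  rw [← lintegral_map hg hTm, aux_map_vol T hT, lintegral_smul_measure, smul_eq_mul]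

lemma aux_lintegral_rot {n : ℕ} (c : ℂ) (hc : ‖c‖ = 1) {g : En n → ℝ≥0∞}
    (hg : Measurable g) :
    ∫⁻ x, g (c • x) ∂vol n = ∫⁻ x, g x ∂vol n := by
  have hd : ‖LinearMap.det (c • (LinearMap.id : En n →ₗ[ℂ] En n))‖ = 1 := by
    rw [LinearMap.det_smul]; simp [hc]
  have := aux_lintegral_lin (c • (LinearMap.id : En n →ₗ[ℂ] En n))
    (by rw [← norm_pos_iff, hd]; norm_num) hg
  rw [hd] at this
  simpa using this

lemma aux_submean_ball {n : ℕ} {g : En n → ℂ} (hg : Measurable g) {r p : ℝ} (hp : 0 < p)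
    (hline : ∀ x, ∀ l : ℂ, ‖l • x‖ < r → DifferentiableAt ℂ (fun l : ℂ => g (l • x)) l) :
    vol n (Metric.ball 0 r) * ENNReal.ofReal (‖g 0‖ ^ p) ≤
      ∫⁻ x in Metric.ball 0 r, ENNReal.ofReal (‖g x‖ ^ p) ∂vol n := by
  set G : En n → ℝ≥0∞ := fun x => ENNReal.ofReal (‖g x‖ ^ p) with hG
  have hGm : Measurable G := (hg.norm.pow_const p).ennreal_ofReal
  set B : Set (En n) := Metric.ball 0 r
  have hBm : MeasurableSet B := Metric.isOpen_ball.measurableSet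
  have hπ : 0 < 2 * Real.pi := by positivity
  have h1 : ENNReal.ofReal (2 * Real.pi) * (vol n B * G 0) ≤
      ENNReal.ofReal (2 * Real.pi) * ∫⁻ x in B, G x ∂vol n := by
    calc ENNReal.ofReal (2 * Real.pi) * (vol n B * G 0) 
        = ∫⁻ x in B, ENNReal.ofReal (2 * Real.pi) * G 0 ∂vol n := by
          rw [setLIntegral_const]; ring
      _ ≤ ∫⁻ x in B, (∫⁻ θ in Set.Ioc 0 (2 * Real.pi), G (circleMap 0 1 θ • x)) ∂vol n := by
          refine setLIntegral_mono' hBm fun x hx => ?_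
          have hx' : ‖x‖ < r := by simpa [B] using hx
          have hr : 0 < r := lt_of_le_of_lt (norm_nonneg _) hx'
          obtain ⟨R, hR, hRx⟩ : ∃ R : ℝ, 1 < R ∧ R * ‖x‖ < r := by
            by_cases hx0 : ‖x‖ = 0
            · exact ⟨2, by norm_num, by rw [hx0]; simpa using hr⟩
            · have hxp : 0 < ‖x‖ := lt_of_le_of_ne (norm_nonneg _) (Ne.symm hx0)
              obtain ⟨R, h1, h2⟩ := exists_between ((one_lt_div hxp).2 hx')
              exact ⟨R, h1, (lt_div_iff₀ hxp).1 h2⟩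
          have := aux_submean1 (h := fun l => g (l • x)) hR hp (by
            intro l hl
            refine (hline x l ?_).differentiableWithinAt
            rw [norm_smul]
            have : ‖l‖ < R := by simpa using hl
            exact lt_of_le_of_lt (by gcongr) hRx)
          simpa [hG] using this
      _ = ∫⁻ θ in Set.Ioc 0 (2 * Real.pi), (∫⁻ x in B, G (circleMap 0 1 θ • x) ∂vol n) := by
          apply lintegral_lintegral_swap
          refine (hGm.comp ?_).aemeasurable
          fun_prop
      _ = ∫⁻ θ in Set.Ioc 0 (2 * Real.pi), (∫⁻ x in B, G x ∂vol n) := by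
          refine lintegral_congr fun θ => ?_
          have hc : ‖circleMap 0 1 θ‖ = 1 := by simp
          have := aux_lintegral_rot (circleMap 0 1 θ) hc (hGm.indicator hBm)
          rw [← lintegral_indicator hBm, ← lintegral_indicator hBm, ← this]
          refine lintegral_congr fun x => ?_
          have : circleMap 0 1 θ • x ∈ B ↔ x ∈ B := by simp [B, norm_smul]
          by_cases hx : x ∈ B
          · rw [Set.indicator_of_mem hx, Set.indicator_of_mem (this.2 hx)]
          · rw [Set.indicator_of_notMem hx, Set.indicator_of_notMem (mt this.1 hx)]
      _ = _ := by
          rw [setLIntegral_const, Real.volume_Ioc]; simp [mul_comm]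
  have h2 : ENNReal.ofReal (2 * Real.pi) ≠ 0 := by simpa using Real.pi_pos
  exact (ENNReal.mul_le_mul_iff_right h2 ENNReal.ofReal_ne_top).1 h1


def Pj {n : ℕ} (z : En n) : En n →L[ℂ] En n := (ℂ ∙ z).starProjection
def sz {n : ℕ} (z : En n) : ℝ := Real.sqrt (1 - ‖z‖ ^ 2)
def Tz {n : ℕ} (z : En n) : En n →L[ℂ] En n :=
  ((sz z : ℝ) : ℂ) • (ContinuousLinearMap.id ℂ (En n) - Pj z) + (((sz z) ^ 2 : ℝ) : ℂ) • Pj z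

lemma aux_herm {n : ℕ} (z w : En n) : herm w z = inner ℂ z w := by
  simp [herm, PiLp.inner_apply]

lemma aux_Pj_apply {n : ℕ} (z w : En n) : Pj z w = (inner ℂ z w / ((‖z‖ ^ 2 : ℝ) : ℂ)) • z := by
  rw [Pj, Submodule.starProjection_singleton]; simp

lemma aux_prj {n : ℕ} (z w : En n) : prj z w = Pj z w := by
  rw [aux_Pj_apply, prj]
  split_ifs with h
  · simp [h]
  · rw [aux_herm, aux_herm, inner_self_eq_norm_sq_to_K]; simp

lemma aux_Pj_self {n : ℕ} (z : En n) : Pj z z = z := by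
  rw [Pj, Submodule.starProjection_eq_self_iff]; exact Submodule.mem_span_singleton_self z

lemma aux_Pj_idem {n : ℕ} (z w : En n) : Pj z (Pj z w) = Pj z w := by
  rw [Pj, Submodule.starProjection_eq_self_iff]; exact Submodule.starProjection_apply_mem _ _

lemma aux_inner_PQ {n : ℕ} (z x y : En n) : inner ℂ (Pj z x) (y - Pj z y) = 0 := by
  have h := Submodule.sub_starProjection_mem_orthogonal (K := (ℂ ∙ z)) y
  exact h _ (Submodule.starProjection_apply_mem _ _)

lemma aux_inner_QP {n : ℕ} (z x y : En n) : inner ℂ (y - Pj z y) (Pj z x) = 0 := by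
  rw [← inner_conj_symm, aux_inner_PQ]; simp

lemma aux_pyth {n : ℕ} (z x y : En n) (a b : ℂ) :
    ‖a • Pj z x + b • (y - Pj z y)‖ ^ 2 = ‖a‖ ^ 2 * ‖Pj z x‖ ^ 2 + ‖b‖ ^ 2 * ‖y - Pj z y‖ ^ 2 := by
  have := norm_add_sq_eq_norm_sq_add_norm_sq_of_inner_eq_zero (𝕜 := ℂ) (a • Pj z x) (b • (y - Pj z y))
    (by rw [inner_smul_left, inner_smul_right, aux_inner_PQ]; simp)
  rw [norm_smul, norm_smul] at this
  nlinarith [this]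

lemma aux_pyth1 {n : ℕ} (z x : En n) : ‖x‖ ^ 2 = ‖Pj z x‖ ^ 2 + ‖x - Pj z x‖ ^ 2 := by
  have := aux_pyth z x x 1 1
  simpa using this

lemma aux_P_le {n : ℕ} (z x : En n) : ‖Pj z x‖ ≤ ‖x‖ := by
  have := aux_pyth1 z x
  exact (pow_le_pow_iff_left₀ (norm_nonneg _) (norm_nonneg _) two_ne_zero).1 (by nlinarith [sq_nonneg ‖x - Pj z x‖])

lemma aux_Q_le {n : ℕ} (z x : En n) : ‖x - Pj z x‖ ≤ ‖x‖ := by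
  have := aux_pyth1 z x
  exact (pow_le_pow_iff_left₀ (norm_nonneg _) (norm_nonneg _) two_ne_zero).1 (by nlinarith [sq_nonneg ‖Pj z x‖])

lemma aux_s_sq {n : ℕ} {z : En n} (hz : z ∈ uball n) : sz z ^ 2 = 1 - ‖z‖ ^ 2 := by
  have : ‖z‖ < 1 := by simpa [uball] using hz
  rw [sz, Real.sq_sqrt]; nlinarith [norm_nonneg z]

lemma aux_s_pos {n : ℕ} {z : En n} (hz : z ∈ uball n) : 0 < sz z := by
  have : ‖z‖ < 1 := by simpa [uball] using hz
  rw [sz]; apply Real.sqrt_pos.2; nlinarith [norm_nonneg z]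

lemma aux_s_le {n : ℕ} {z : En n} : sz z ≤ 1 := by
  rw [sz]; apply Real.sqrt_le_one.2; nlinarith [norm_nonneg z]

lemma aux_det {n : ℕ} (z : En n) :
    LinearMap.det (Tz z : En n →ₗ[ℂ] En n) = ((sz z ^ (n + 1) : ℝ) : ℂ) := by
  by_cases h0 : z = 0
  · have hs : sz z = 1 := by simp [sz, h0]
    have : (Tz z : En n →ₗ[ℂ] En n) = LinearMap.id := by
      ext x; simp [Tz, hs]
    rw [this, hs]; simp
  · set s : ℝ := sz z
    set φ : Module.Dual ℂ (En n) := (((s - 1) / ‖z‖ ^ 2 : ℝ) : ℂ) • (innerSL ℂ z : En n →ₗ[ℂ] ℂ)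
    have : (Tz z : En n →ₗ[ℂ] En n) = (s : ℂ) • LinearMap.transvection φ z := by
      ext1 x
      simp only [Tz, φ, LinearMap.transvection, ContinuousLinearMap.toLinearMap_add,
        ContinuousLinearMap.toLinearMap_smul, LinearMap.add_apply, LinearMap.smul_apply,
        ContinuousLinearMap.coe_coe, _root_.sub_apply, ContinuousLinearMap.id_apply]
      simp [aux_Pj_apply, smul_sub, smul_smul]
      module
    rw [this, LinearMap.det_smul, LinearMap.transvection.det]
    have hz' : (‖z‖ : ℂ) ≠ 0 := by simpa using h0
    have : φ z = ((s - 1 : ℝ) : ℂ) := by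
      simp [φ, inner_self_eq_norm_sq_to_K]
      field_simp
    rw [this, finrank_euclideanSpace_fin]
    push_cast; ring

lemma aux_mob {n : ℕ} (z w : En n) : mobius z w = ((1 : ℂ) / (1 - inner ℂ z w)) •
    (z - Pj z w - ((sz z : ℝ) : ℂ) • (w - Pj z w)) := by
  rw [mobius, aux_prj, aux_herm, sz]

lemma aux_mob_num {n : ℕ} {z w : En n} (hz : z ∈ uball n) :
    ‖z - Pj z w - ((sz z : ℝ) : ℂ) • (w - Pj z w)‖ ^ 2 =
      ‖1 - inner ℂ z w‖ ^ 2 - (1 - ‖z‖ ^ 2) * (1 - ‖w‖ ^ 2) := by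
  have h1 : z - Pj z w - ((sz z : ℝ) : ℂ) • (w - Pj z w) =
      (1 : ℂ) • Pj z (z - w) + (-((sz z : ℝ) : ℂ)) • (w - Pj z w) := by
    rw [map_sub, aux_Pj_self]; module
  rw [h1, aux_pyth, norm_neg, Complex.norm_real, Real.norm_of_nonneg (aux_s_pos hz).le, aux_s_sq hz]
  have h2 : ‖w - Pj z w‖ ^ 2 = ‖w‖ ^ 2 - ‖Pj z w‖ ^ 2 := by linarith [aux_pyth1 z w]
  rw [h2, map_sub, aux_Pj_self]
  by_cases h0 : z = 0
  · simp [h0, Pj]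
  have hz' : ‖z‖ ≠ 0 := by simpa using h0
  set a : ℂ := inner ℂ z w
  have h3 : ‖z - Pj z w‖ ^ 2 = ‖(1 : ℂ) - a / ((‖z‖ ^ 2 : ℝ) : ℂ)‖ ^ 2 * ‖z‖ ^ 2 := by
    rw [aux_Pj_apply, ← mul_pow, ← norm_smul, sub_smul, one_smul]
  have h4 : ‖Pj z w‖ ^ 2 = ‖a / ((‖z‖ ^ 2 : ℝ) : ℂ)‖ ^ 2 * ‖z‖ ^ 2 := by
    rw [aux_Pj_apply, ← mul_pow, ← norm_smul]
  rw [h3, h4]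
  simp only [Complex.sq_norm, Complex.normSq_apply, Complex.sub_re, Complex.sub_im, Complex.one_re,
    Complex.one_im, Complex.div_ofReal_re, Complex.div_ofReal_im]
  field_simp
  ring

lemma aux_inner_ne {n : ℕ} {z w : En n} (hz : z ∈ uball n) (hw : w ∈ uball n) :
    1 - ‖z‖ ≤ ‖1 - inner ℂ z w‖ ∧ 1 - ‖w‖ ≤ ‖1 - inner ℂ z w‖ := by
  have h1 : ‖z‖ < 1 := by simpa [uball] using hz
  have h2 : ‖w‖ < 1 := by simpa [uball] using hw
  have h3 : ‖inner ℂ z w‖ ≤ ‖z‖ * ‖w‖ := norm_inner_le_norm z w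
  have h4 : ‖(1:ℂ)‖ - ‖inner ℂ z w‖ ≤ ‖1 - inner ℂ z w‖ := norm_sub_norm_le _ _
  rw [norm_one] at h4
  constructor <;> nlinarith [norm_nonneg z, norm_nonneg w]

lemma aux_mob_norm {n : ℕ} {z w : En n} (hz : z ∈ uball n) (hw : w ∈ uball n) :
    ‖mobius z w‖ ^ 2 * ‖1 - inner ℂ z w‖ ^ 2 =
      ‖1 - inner ℂ z w‖ ^ 2 - (1 - ‖z‖ ^ 2) * (1 - ‖w‖ ^ 2) := by
  have h1 : ‖z‖ < 1 := by simpa [uball] using hz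
  have h : ‖1 - inner ℂ z w‖ ≠ 0 := by have := (aux_inner_ne hz hw).1; linarith
  rw [aux_mob, norm_smul, mul_pow, aux_mob_num hz, norm_div, norm_one]
  field_simp

def Rg (γ : ℝ) : ℝ := (Real.exp (2 * γ) - 1) / (Real.exp (2 * γ) + 1)
lemma aux_Rg {γ : ℝ} (hγ : 0 < γ) : 0 < Rg γ ∧ Rg γ < 1 := by
  have : 1 < Real.exp (2 * γ) := Real.one_lt_exp_iff.2 (by linarith)
  unfold Rg
  constructor
  · apply div_pos <;> linarith
  · rw [div_lt_one] <;> linarith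

lemma aux_mob_lt {n : ℕ} {z w : En n} (hz : z ∈ uball n) (hw : w ∈ uball n) : ‖mobius z w‖ < 1 := by
  have h := aux_mob_norm hz hw
  have h1 : ‖z‖ < 1 := by simpa [uball] using hz
  have h2 : ‖w‖ < 1 := by simpa [uball] using hw
  have h3 : 0 < (1 - ‖z‖ ^ 2) * (1 - ‖w‖ ^ 2) := by
    apply mul_pos <;> nlinarith [norm_nonneg z, norm_nonneg w]
  by_contra hc
  push Not at hc
  have : 1 ≤ ‖mobius z w‖ ^ 2 := by nlinarith
  nlinarith [sq_nonneg ‖1 - inner ℂ z w‖]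

lemma aux_mem_D {n : ℕ} {z w : En n} {γ : ℝ} (hz : z ∈ uball n) (hw : w ∈ uball n) :
    w ∈ Dball z γ ↔ ‖mobius z w‖ < Rg γ := by
  have h1 := aux_mob_lt hz hw
  have h0 := norm_nonneg (mobius z w)
  have he := Real.exp_pos (2 * γ)
  simp only [Dball, Set.mem_ofPred_eq, hw, true_and, bmet]
  rw [show (1 / 2 * Real.log ((1 + ‖mobius z w‖) / (1 - ‖mobius z w‖)) < γ) ↔
    Real.log ((1 + ‖mobius z w‖) / (1 - ‖mobius z w‖)) < 2 * γ by constructor <;> intro h <;> linarith,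
    Real.log_lt_iff_lt_exp (div_pos (by linarith) (by linarith)), div_lt_iff₀ (by linarith), Rg,
    lt_div_iff₀ (by linarith)]
  constructor <;> intro h <;> linarith

lemma aux_D_in {n : ℕ} {z w : En n} {γ δ : ℝ} (hz : z ∈ uball n) (hw : w ∈ uball n)
    (h1 : ‖Pj z (z - w)‖ ≤ δ * sz z ^ 2) (h2 : ‖(z - w) - Pj z (z - w)‖ ≤ δ * sz z)
    (hδ : 4 * δ < Rg γ) : w ∈ Dball z γ := by
  rw [aux_mem_D hz hw]
  refine lt_of_le_of_lt ?_ hδ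
  have hz1 : ‖z‖ < 1 := by simpa [uball] using hz
  have hpos : 0 < ‖1 - inner ℂ z w‖ := by have := (aux_inner_ne hz hw).1; linarith
  rw [aux_mob, norm_smul, norm_div, norm_one, one_div, inv_mul_le_iff₀ hpos]
  have e : z - Pj z w - ((sz z : ℝ) : ℂ) • (w - Pj z w) =
      Pj z (z - w) + ((sz z : ℝ) : ℂ) • ((z - w) - Pj z (z - w)) := by
    rw [map_sub, aux_Pj_self]; module
  rw [e]
  have hs := aux_s_pos hz
  have hs2 := aux_s_sq hz
  have hδ0 : 0 ≤ δ := by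
    by_contra hc; push Not at hc
    have := norm_nonneg ((z - w) - Pj z (z - w)); nlinarith
  calc _ ≤ ‖Pj z (z - w)‖ + ‖((sz z : ℝ) : ℂ) • ((z - w) - Pj z (z - w))‖ := norm_add_le _ _
    _ ≤ δ * sz z ^ 2 + sz z * (δ * sz z) := by
        rw [norm_smul, Complex.norm_real, Real.norm_of_nonneg hs.le]; gcongr
    _ = 2 * δ * ((1 - ‖z‖) * (1 + ‖z‖)) := by rw [show sz z * (δ * sz z) = δ * sz z ^ 2 by ring, hs2]; ring
    _ ≤ 2 * δ * (‖1 - inner ℂ z w‖ * 2) := by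
        gcongr
        · exact (aux_inner_ne hz hw).1
        · linarith
    _ = _ := by ring

def relQ {n : ℕ} (K : ℝ) (z w : En n) : Prop :=
  ‖1 - inner ℂ z w‖ ^ 2 ≤ K * ((1 - ‖z‖ ^ 2) * (1 - ‖w‖ ^ 2))

lemma aux_D_out {n : ℕ} {z w : En n} {γ : ℝ} (hγ : 0 < γ) (hz : z ∈ uball n) (hw : w ∈ Dball z γ) :
    relQ (1 - Rg γ ^ 2)⁻¹ z w := by
  have hwb := hw.1
  rw [aux_mem_D hz hw.1] at hw
  have hR := aux_Rg hγ
  have h := aux_mob_norm hz hwb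
  have hR2 : 0 < 1 - Rg γ ^ 2 := by nlinarith
  unfold relQ
  rw [← div_eq_inv_mul, le_div_iff₀ hR2]
  have : ‖mobius z w‖ ^ 2 ≤ Rg γ ^ 2 := by gcongr
  nlinarith [sq_nonneg ‖1 - inner ℂ z w‖]

lemma aux_relQ_symm {n : ℕ} {K : ℝ} {z w : En n} (h : relQ K z w) : relQ K w z := by
  unfold relQ at *
  have : ‖1 - inner ℂ w z‖ = ‖1 - inner ℂ z w‖ := by
    rw [← inner_conj_symm w z, ← Complex.norm_conj]; simp
  rw [this]; linarith


lemma aux_ub {n : ℕ} {z : En n} : z ∈ uball n ↔ ‖z‖ < 1 := by simp [uball]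

lemma aux_T_apply {n : ℕ} (z x : En n) : Tz z x =
    (((sz z) ^ 2 : ℝ) : ℂ) • Pj z x + ((sz z : ℝ) : ℂ) • (x - Pj z x) := by
  simp [Tz, add_comm]

lemma aux_T_norm {n : ℕ} {z : En n} (hz : z ∈ uball n) (x : En n) : ‖Tz z x‖ ≤ sz z * ‖x‖ := by
  have hs := aux_s_pos hz
  have h1 := aux_s_le (z := z)
  refine (pow_le_pow_iff_left₀ (norm_nonneg _) (by positivity) two_ne_zero).1 ?_
  rw [aux_T_apply, aux_pyth, Complex.norm_real, Complex.norm_real, Real.norm_of_nonneg hs.le,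
    Real.norm_of_nonneg (by positivity), mul_pow, aux_pyth1 z x]
  have h3 : sz z ^ 2 ≤ 1 := by nlinarith
  have : (sz z ^ 2) ^ 2 ≤ sz z ^ 2 := by nlinarith [sq_nonneg (sz z)]
  nlinarith [sq_nonneg ‖Pj z x‖]

lemma aux_P_inner {n : ℕ} (z x : En n) : inner ℂ z (Pj z x) = inner ℂ z x := by
  have h := aux_inner_PQ z z x
  rw [aux_Pj_self, inner_sub_right] at h
  exact (sub_eq_zero.1 h).symm

/-- norm of psi -/
lemma aux_psi {n : ℕ} {z : En n} (hz : z ∈ uball n) {x : En n} (hx : ‖x‖ ≤ 1 / 8) :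
    sz z ^ 2 / 2 ≤ 1 - ‖z + Tz z x‖ ^ 2 ∧ 1 - ‖z + Tz z x‖ ^ 2 ≤ 2 * sz z ^ 2 := by
  have hs := aux_s_pos hz
  have h1 := aux_s_le (z := z)
  have hs2 := aux_s_sq hz
  have hz1 := aux_ub.1 hz
  have e : ‖z + Tz z x‖ ^ 2 = ‖z‖ ^ 2 + 2 * RCLike.re (inner ℂ z (Tz z x)) + ‖Tz z x‖ ^ 2 :=
    norm_add_sq (𝕜 := ℂ) z (Tz z x)
  have e2 : inner ℂ z (Tz z x) = ((sz z ^ 2 : ℝ) : ℂ) * inner ℂ z x := by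
    rw [aux_T_apply, inner_add_right, inner_smul_right, inner_smul_right, inner_sub_right,
      aux_P_inner]; simp
  have e3 : |RCLike.re (inner ℂ z (Tz z x))| ≤ sz z ^ 2 * (1 / 8) := by
    refine (RCLike.abs_re_le_norm _).trans ?_
    rw [e2, norm_mul, Complex.norm_real, Real.norm_of_nonneg (by positivity)]
    gcongr
    refine (norm_inner_le_norm z x).trans ?_
    nlinarith [norm_nonneg z, norm_nonneg x]
  have e4 : ‖Tz z x‖ ^ 2 ≤ sz z ^ 2 * (1 / 8) ^ 2 := by
    rw [← mul_pow]
    gcongr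
    exact (aux_T_norm hz x).trans (by gcongr)
  have := abs_le.1 e3
  have h5 := sq_nonneg ‖Tz z x‖
  constructor <;> nlinarith

lemma aux_psi_mem {n : ℕ} {z : En n} (hz : z ∈ uball n) {x : En n} (hx : ‖x‖ ≤ 1 / 8) :
    z + Tz z x ∈ uball n := by
  have := (aux_psi hz hx).1
  have hs := aux_s_pos hz
  rw [aux_ub]
  by_contra hc
  push Not at hc
  nlinarith [sq_nonneg (sz z)]

lemma aux_relQ_comp {n : ℕ} {K : ℝ} {z w : En n} (hz : z ∈ uball n) (hw : w ∈ uball n)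
    (h : relQ K z w) : 1 - ‖w‖ ^ 2 ≤ 4 * K * (1 - ‖z‖ ^ 2) := by
  have h1 := (aux_inner_ne hz hw).2
  have hw1 := aux_ub.1 hw
  have h2 : (1 - ‖w‖ ^ 2) / 2 ≤ ‖1 - inner ℂ z w‖ := by nlinarith [norm_nonneg w]
  have h3 : 0 < 1 - ‖w‖ ^ 2 := by nlinarith [norm_nonneg w]
  have h4 : ((1 - ‖w‖ ^ 2) / 2) ^ 2 ≤ ‖1 - inner ℂ z w‖ ^ 2 := by gcongr
  unfold relQ at h
  have h5 : (1 - ‖w‖ ^ 2) * (1 - ‖w‖ ^ 2) ≤ (4 * K * (1 - ‖z‖ ^ 2)) * (1 - ‖w‖ ^ 2) := by nlinarith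
  exact le_of_mul_le_mul_right h5 h3

lemma aux_relQ_inner {n : ℕ} {K : ℝ} {z w : En n} (hK : 1 ≤ K) (hz : z ∈ uball n) (hw : w ∈ uball n)
    (h : relQ K z w) : ‖1 - inner ℂ z w‖ ≤ 2 * K * sz w ^ 2 := by
  have h1 := aux_relQ_comp hw hz (aux_relQ_symm h)
  have hw1 := aux_ub.1 hw
  have h3 : 0 < 1 - ‖w‖ ^ 2 := by nlinarith [norm_nonneg w]
  rw [aux_s_sq hw]
  refine (pow_le_pow_iff_left₀ (norm_nonneg _) (by positivity) two_ne_zero).1 ?_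
  unfold relQ at h
  have h4 : K * ((1 - ‖z‖ ^ 2) * (1 - ‖w‖ ^ 2)) ≤ K * ((4 * K * (1 - ‖w‖ ^ 2)) * (1 - ‖w‖ ^ 2)) := by
    gcongr
  nlinarith

lemma aux_relQ_Q {n : ℕ} {K : ℝ} {z w : En n} (hK : 1 ≤ K) (hz : z ∈ uball n) (hw : w ∈ uball n)
    (h : relQ K z w) : ‖z - Pj w z‖ ≤ 2 * K * sz w := by
  have h1 := aux_relQ_inner hK hz hw h
  have hs := aux_s_pos hw
  have hz1 := aux_ub.1 hz
  have hw1 := aux_ub.1 hw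
  refine (pow_le_pow_iff_left₀ (norm_nonneg _) (by positivity) two_ne_zero).1 ?_
  have h2 := aux_pyth1 w z
  -- |inner z w| ≤ ‖Pj w z‖
  have h3 : ‖inner ℂ z w‖ ≤ ‖Pj w z‖ := by
    have : inner ℂ w (Pj w z) = inner ℂ w z := aux_P_inner w z
    rw [← norm_inner_symm, ← this]
    refine (norm_inner_le_norm _ _).trans ?_
    nlinarith [norm_nonneg (Pj w z)]
  have h4 : ‖(1:ℂ)‖ - ‖inner ℂ z w‖ ≤ ‖1 - inner ℂ z w‖ := norm_sub_norm_le _ _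
  rw [norm_one] at h4
  have h5 : ‖Pj w z‖ ≤ 1 := (aux_P_le w z).trans hz1.le
  have h6 : ‖z - Pj w z‖ ^ 2 ≤ 2 * ‖1 - inner ℂ z w‖ := by
    nlinarith [norm_nonneg (Pj w z), norm_nonneg z]
  have h7 : 0 < sz w ^ 2 := by positivity
  nlinarith

lemma aux_relQ_tri {n : ℕ} {K : ℝ} {z w x : En n} (hK : 1 ≤ K) (hz : z ∈ uball n) (hw : w ∈ uball n)
    (h : relQ K z w) (hx : ‖x‖ ≤ 1 / 8) : relQ (72 * K ^ 3) z (w + Tz w x) := by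
  have h1 := aux_relQ_inner hK hz hw h
  have h2 := aux_relQ_Q hK hz hw h
  have h3 := aux_relQ_comp hz hw h
  have hs := aux_s_pos hw
  have hz1 := aux_ub.1 hz
  have hps := (aux_psi hw hx).1
  have e : inner ℂ z (Tz w x) = ((sz w ^ 2 : ℝ) : ℂ) * inner ℂ z (Pj w x) +
      ((sz w : ℝ) : ℂ) * inner ℂ (z - Pj w z) (x - Pj w x) := by
    rw [aux_T_apply, inner_add_right, inner_smul_right, inner_smul_right, inner_sub_left,
      aux_inner_PQ, sub_zero]
  have h4 : ‖inner ℂ z (Tz w x)‖ ≤ sz w ^ 2 * (1 / 8) + sz w * (2 * K * sz w * (1 / 8)) := by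
    rw [e]
    refine (norm_add_le _ _).trans ?_
    rw [norm_mul, norm_mul, Complex.norm_real, Complex.norm_real, Real.norm_of_nonneg hs.le,
      Real.norm_of_nonneg (by positivity)]
    gcongr
    · refine (norm_inner_le_norm _ _).trans ?_
      have := (aux_P_le w x).trans hx
      nlinarith [norm_nonneg z, norm_nonneg (Pj w x)]
    · refine (norm_inner_le_norm _ _).trans ?_
      have := (aux_Q_le w x).trans hx
      gcongr
  have h5 : ‖1 - inner ℂ z (w + Tz w x)‖ ≤ 3 * K * sz w ^ 2 := by
    rw [inner_add_right, ← sub_sub]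
    refine (norm_sub_le _ _).trans ?_
    nlinarith [sq_nonneg (sz w)]
  unfold relQ
  have h6 : ‖1 - inner ℂ z (w + Tz w x)‖ ^ 2 ≤ (3 * K * sz w ^ 2) ^ 2 := by gcongr
  refine h6.trans ?_
  have h7 : sz w ^ 2 ≤ 2 * (1 - ‖w + Tz w x‖ ^ 2) := by linarith
  rw [← aux_s_sq hw] at h3
  have h8 : 0 < sz w ^ 2 := by positivity
  calc (3 * K * sz w ^ 2) ^ 2 = 9 * K ^ 2 * (sz w ^ 2 * sz w ^ 2) := by ring
    _ ≤ 9 * K ^ 2 * ((4 * K * (1 - ‖z‖ ^ 2)) * (2 * (1 - ‖w + Tz w x‖ ^ 2))) := by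
        gcongr
        exact h8.le.trans h3
    _ = _ := by ring

lemma aux_relQ_img {n : ℕ} {K : ℝ} {z w : En n} (hK : 1 ≤ K) (hz : z ∈ uball n) (hw : w ∈ uball n)
    (h : relQ K z w) : ∃ x : En n, ‖x‖ < 9 * K ∧ z = w + Tz w x := by
  have h1 := aux_relQ_inner hK hz hw h
  have h2 := aux_relQ_Q hK hz hw h
  have hs := aux_s_pos hw
  have hs2 := aux_s_sq hw
  have hz1 := aux_ub.1 hz
  have hw1 := aux_ub.1 hw
  set s := sz w
  have hsC : (s : ℂ) ≠ 0 := by exact_mod_cast hs.ne'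
  set x : En n := ((s ^ 2 : ℝ) : ℂ)⁻¹ • Pj w (z - w) + (s : ℂ)⁻¹ • (z - Pj w z) with hx
  have hPx : Pj w x = ((s ^ 2 : ℝ) : ℂ)⁻¹ • Pj w (z - w) := by
    rw [hx, map_add, map_smul, map_smul, aux_Pj_idem, map_sub _ z (Pj w z), aux_Pj_idem, sub_self, smul_zero, add_zero]
  refine ⟨x, ?_, ?_⟩
  · have hP : ‖Pj w (z - w)‖ ≤ 6 * K * s ^ 2 := by
      by_cases hh : ‖w‖ < 1 / 2
      · have h3 : ‖Pj w (z - w)‖ ≤ 2 := (aux_P_le w _).trans ((norm_sub_le _ _).trans (by linarith))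
        have h4 : 3 / 4 ≤ s ^ 2 := by rw [hs2]; nlinarith [norm_nonneg w]
        nlinarith
      · push Not at hh
        have hw0 : ‖w‖ ≠ 0 := by linarith
        rw [aux_Pj_apply, norm_smul, norm_div, Complex.norm_real, Real.norm_of_nonneg (by positivity)]
        have e1 : inner ℂ w (z - w) = (s ^ 2 : ℝ) - (1 - inner ℂ w z) := by
          rw [inner_sub_right, inner_self_eq_norm_sq_to_K, hs2]; push_cast
          simp
        have e2 : ‖inner ℂ w (z - w)‖ ≤ s ^ 2 + 2 * K * s ^ 2 := by
          rw [e1]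
          refine (norm_sub_le _ _).trans ?_
          rw [Complex.norm_real, Real.norm_of_nonneg (by positivity)]
          have : ‖1 - inner ℂ w z‖ = ‖1 - inner ℂ z w‖ := by
            rw [← inner_conj_symm w z, ← Complex.norm_conj]; simp
          rw [this]; gcongr
        rw [div_mul_eq_mul_div, div_le_iff₀ (by positivity), pow_two ‖w‖, ← mul_assoc]
        gcongr
        refine e2.trans ?_
        have h9 : 6 * K * s ^ 2 * (1 / 2) ≤ 6 * K * s ^ 2 * ‖w‖ := by gcongr
        have h10 := mul_le_mul_of_nonneg_right hK (sq_nonneg s)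
        linarith
    have h3 : ‖x‖ ≤ 6 * K + 2 * K := by
      refine (norm_add_le _ _).trans ?_
      rw [norm_smul, norm_smul, norm_inv, norm_inv, Complex.norm_real, Complex.norm_real,
        Real.norm_of_nonneg hs.le, Real.norm_of_nonneg (by positivity)]
      refine add_le_add ?_ ?_
      · rw [inv_mul_le_iff₀ (by positivity)]; linarith
      · rw [inv_mul_le_iff₀ (by positivity)]; linarith
    linarith
  · rw [aux_T_apply, hPx, smul_inv_smul₀ (by exact_mod_cast (pow_ne_zero 2 hs.ne'))]
    have : x - ((s ^ 2 : ℝ) : ℂ)⁻¹ • Pj w (z - w) = (s : ℂ)⁻¹ • (z - Pj w z) := by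
      rw [hx]; abel
    rw [this, smul_inv_smul₀ hsC, map_sub, aux_Pj_self]; abel

lemma aux_relQ_vol {n : ℕ} {K : ℝ} {w : En n} (hK : 1 ≤ K) (hw : w ∈ uball n) :
    vol n {z | z ∈ uball n ∧ relQ K z w} ≤
      ENNReal.ofReal ((1 - ‖w‖ ^ 2) ^ (n + 1)) * vol n (Metric.ball 0 (9 * K)) := by
  have hsub : {z | z ∈ uball n ∧ relQ K z w} ⊆ (fun y => w + y) '' (Tz w '' (Metric.ball 0 (9 * K))) := by
    rintro z ⟨hz, h⟩
    obtain ⟨x, hx, rfl⟩ := aux_relQ_img hK hz hw h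
    exact ⟨_, ⟨x, by simpa using hx, rfl⟩, rfl⟩
  refine (measure_mono hsub).trans ?_
  rw [Set.image_add_left, measure_preimage_add]
  have h1 : LinearMap.det ((Tz w : En n →ₗ[ℂ] En n).restrictScalars ℝ) = (1 - ‖w‖ ^ 2) ^ (n + 1) := by
    rw [LinearMap.det_restrictScalars, Algebra.norm_complex_apply, Complex.normSq_eq_norm_sq,
      aux_det, Complex.norm_real, Real.norm_of_nonneg (pow_nonneg (aux_s_pos hw).le _), ← aux_s_sq hw]
    ring
  have := Measure.addHaar_image_linearMap (vol n) ((Tz w : En n →ₗ[ℂ] En n).restrictScalars ℝ) (Metric.ball 0 (9 * K))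
  rw [h1, abs_of_nonneg (by have := aux_s_sq hw; rw [← this]; positivity)] at this
  exact this.le

lemma aux_mob_deriv {n : ℕ} (w : En n) (hw : w ∈ uball n) : HasFDerivAt (mobius w) (-(Tz w)) 0 := by
  have h1 : HasFDerivAt (fun y : En n => (1 - inner ℂ w y)⁻¹) (innerSL ℂ w) 0 := by
    have hd : HasFDerivAt (fun y : En n => (1 : ℂ) - inner ℂ w y) (-(innerSL ℂ w)) 0 :=
      (innerSL ℂ w).hasFDerivAt.const_sub 1
    have := (hasDerivAt_inv (x := (1 : ℂ) - inner ℂ w 0) (by simp)).comp_hasFDerivAt (0 : En n) hd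
    simpa using! this
  set L : En n →L[ℂ] En n := Pj w + ((sz w : ℝ) : ℂ) • (ContinuousLinearMap.id ℂ _ - Pj w)
  have h2 : HasFDerivAt (fun y : En n => w - L y) (-L) 0 := L.hasFDerivAt.const_sub w
  have h3 := h1.smul h2
  have e : mobius w = fun y => (1 - inner ℂ w y)⁻¹ • (w - L y) := by
    funext y
    rw [aux_mob, one_div]
    congr 1
    simp [L]; abel
  rw [e]
  refine h3.congr_fderiv ?_
  ext1 y
  have hPw : (inner ℂ w y : ℂ) • w = ((‖w‖ ^ 2 : ℝ) : ℂ) • Pj w y := by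
    by_cases h0 : w = 0
    · simp [h0]
    rw [aux_Pj_apply, smul_smul, mul_div_cancel₀]
    have : ‖w‖ ≠ 0 := by simpa using h0
    exact_mod_cast pow_ne_zero 2 this
  have hs2 : ((sz w ^ 2 : ℝ) : ℂ) = 1 - ((‖w‖ ^ 2 : ℝ) : ℂ) := by
    rw [aux_s_sq hw]; push_cast; ring
  simp only [neg_apply, aux_T_apply, hs2]
  simp [L, -Complex.coe_smul]
  rw [hPw]
  push_cast
  module


lemma aux_uball_meas (n : ℕ) : MeasurableSet (uball n) := measurableSet_ball

instance instSFTau (n : ℕ) : SFinite (measTau n) := by unfold measTau; infer_instance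
instance instSFA (n : ℕ) (α : ℝ) : SFinite (measA n α) := by unfold measA; infer_instance

lemma aux_dens_tau (n : ℕ) :
    Measurable (fun z : En n => ENNReal.ofReal ((1 - ‖z‖ ^ 2) ^ (-((n : ℝ) + 1)))) := by
  fun_prop

lemma aux_dens_A (n : ℕ) (α : ℝ) :
    Measurable (fun z : En n => ENNReal.ofReal (cnorm n α * (1 - ‖z‖ ^ 2) ^ α)) := by
  fun_prop

lemma aux_tau_set {n : ℕ} {S : Set (En n)} (hS : MeasurableSet S) {h : En n → ℝ≥0∞}
    (hh : Measurable h) : ∫⁻ w in S, h w ∂measTau n =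
      ∫⁻ w, (uball n ∩ S).indicator (fun w => ENNReal.ofReal ((1 - ‖w‖ ^ 2) ^ (-((n : ℝ) + 1))) * h w) w ∂vol n := by
  rw [lintegral_indicator ((aux_uball_meas n).inter hS), measTau, restrict_withDensity hS,
    lintegral_withDensity_eq_lintegral_mul _ (aux_dens_tau n) hh, Measure.restrict_restrict hS, Set.inter_comm]
  rfl

lemma aux_A_int {n : ℕ} {α : ℝ} {h : En n → ℝ≥0∞}
    (hh : Measurable h) : ∫⁻ w, h w ∂measA n α =
      ∫⁻ w in uball n, ENNReal.ofReal (cnorm n α * (1 - ‖w‖ ^ 2) ^ α) * h w ∂vol n := by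
  rw [measA, lintegral_withDensity_eq_lintegral_mul _ (aux_dens_A n α) hh]
  rfl

lemma aux_A_congr {n : ℕ} {α : ℝ} {h k : En n → ℝ≥0∞} (hhk : ∀ z ∈ uball n, h z = k z) :
    ∫⁻ w, h w ∂measA n α = ∫⁻ w, k w ∂measA n α := by
  apply lintegral_congr_ae
  unfold measA
  refine (withDensity_absolutelyContinuous _ _).ae_le ?_
  exact (ae_restrict_iff' (aux_uball_meas n)).2 (ae_of_all _ hhk)

lemma aux_A_mono {n : ℕ} {α : ℝ} {h k : En n → ℝ≥0∞} (hhk : ∀ z ∈ uball n, h z ≤ k z) :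
    ∫⁻ w, h w ∂measA n α ≤ ∫⁻ w, k w ∂measA n α := by
  apply lintegral_mono_ae
  unfold measA
  refine (withDensity_absolutelyContinuous _ _).ae_le ?_
  exact (ae_restrict_iff' (aux_uball_meas n)).2 (ae_of_all _ hhk)

/-- change of variables, inequality -/
lemma aux_cov {n : ℕ} {u : En n} (hu : u ∈ uball n) {δ : ℝ} (hδ : δ ≤ 1 / 8) {S : Set (En n)}
    (hS : MeasurableSet S) (hsub : ∀ x, ‖x‖ < δ → u + Tz u x ∈ S) {h : En n → ℝ≥0∞}
    (hh : Measurable h) :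
    ∫⁻ x in Metric.ball 0 δ, h (u + Tz u x) ∂vol n ≤ 2 ^ (n + 1) * ∫⁻ w in S, h w ∂measTau n := by
  have hs := aux_s_pos hu
  rw [aux_tau_set hS hh]
  set k : En n → ℝ≥0∞ := (uball n ∩ S).indicator
    (fun w => ENNReal.ofReal ((1 - ‖w‖ ^ 2) ^ (-((n : ℝ) + 1))) * h w) with hk
  have hkm : Measurable k := ((aux_dens_tau n).mul hh).indicator ((aux_uball_meas n).inter hS)
  set c : ℝ≥0∞ := ENNReal.ofReal (2 ^ (n + 1) * (sz u ^ 2) ^ (n + 1)) with hc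
  have h1 : ∀ x ∈ Metric.ball (0 : En n) δ, h (u + Tz u x) ≤ c * k (u + Tz u x) := by
    intro x hx
    have hx' : ‖x‖ < δ := by simpa using hx
    have hx8 : ‖x‖ ≤ 1 / 8 := hx'.le.trans hδ
    have hm : u + Tz u x ∈ uball n ∩ S := ⟨aux_psi_mem hu hx8, hsub x hx'⟩
    rw [hk, Set.indicator_of_mem hm, ← mul_assoc, hc, ← ENNReal.ofReal_mul (by positivity)]
    have hps := aux_psi hu hx8
    have hpos : 0 < 1 - ‖u + Tz u x‖ ^ 2 := lt_of_lt_of_le (by positivity) hps.1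
    have : 1 ≤ 2 ^ (n + 1) * (sz u ^ 2) ^ (n + 1) * (1 - ‖u + Tz u x‖ ^ 2) ^ (-((n : ℝ) + 1)) := by
      rw [Real.rpow_neg hpos.le, ← div_eq_mul_inv, one_le_div (by positivity)]
      have : ((n : ℝ) + 1) = ((n + 1 : ℕ) : ℝ) := by push_cast; ring
      rw [this, Real.rpow_natCast, ← mul_pow]
      gcongr
      exact hps.2
    calc h (u + Tz u x) = 1 * h (u + Tz u x) := (one_mul _).symm
      _ ≤ _ := by
        gcongr
        rw [ENNReal.one_le_ofReal]; exact this
  have h2 : ∫⁻ x in Metric.ball 0 δ, h (u + Tz u x) ∂vol n ≤ ∫⁻ x, c * k (u + Tz u x) ∂vol n := by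
    refine (setLIntegral_mono' measurableSet_ball h1).trans (setLIntegral_le_lintegral _ _)
  refine h2.trans ?_
  have hm2 : Measurable (fun y => k (u + y)) := hkm.comp (measurable_const_add u)
  have hdet : LinearMap.det (Tz u : En n →ₗ[ℂ] En n) ≠ 0 := by
    rw [aux_det]; exact_mod_cast (pow_pos hs _).ne'
  rw [lintegral_const_mul c (show Measurable (fun x => k (u + Tz u x)) from hm2.comp (Tz u).continuous.measurable)]
  have h3 := aux_lintegral_lin (Tz u : En n →ₗ[ℂ] En n) hdet hm2
  simp only [ContinuousLinearMap.coe_coe] at h3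
  rw [h3, lintegral_add_left_eq_self k u, ← mul_assoc, hc, ← ENNReal.ofReal_mul (by positivity), aux_det, Complex.norm_real,
    Real.norm_of_nonneg (by positivity)]
  gcongr
  have : 2 ^ (n + 1) * (sz u ^ 2) ^ (n + 1) * ((sz u ^ (n + 1)) ^ 2)⁻¹ = (2 : ℝ) ^ (n + 1) := by
    have : (sz u ^ 2) ^ (n + 1) = (sz u ^ (n + 1)) ^ 2 := by ring
    rw [this, mul_assoc, mul_inv_cancel₀ (by positivity), mul_one]
  rw [this, ENNReal.ofReal_pow (by norm_num)]
  simp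

lemma aux_submean_ell {n : ℕ} {g : En n → ℂ} (hg : Measurable g) {p δ : ℝ} (hp : 0 < p)
    (hδ : δ ≤ 1 / 8) {u y : En n} (hu : u ∈ uball n) 
    (hy : ‖y‖ + δ ≤ 1 / 8)
    (hline : ∀ z x : En n, ∀ l : ℂ, z + l • x ∈ uball n → DifferentiableAt ℂ (fun l : ℂ => g (z + l • x)) l) :
    vol n (Metric.ball 0 δ) * ENNReal.ofReal (‖g (u + Tz u y)‖ ^ p) ≤
      ∫⁻ x in Metric.ball 0 δ, ENNReal.ofReal (‖g (u + Tz u (y + x))‖ ^ p) ∂vol n := by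
  have := aux_submean_ball (n := n) (g := fun x => g (u + Tz u (y + x))) (r := δ) (p := p)
    (hg.comp (by have := (Tz u).continuous; fun_prop)) hp ?_
  · simpa using this
  · intro x l hl
    have h1 := hline (u + Tz u y) (Tz u x) l (by
      have := aux_psi_mem (z := u) hu (x := y + l • x) (by
        refine (norm_add_le _ _).trans ?_
        linarith)
      simpa [add_assoc] using this)
    simpa [add_assoc] using h1

lemma aux_radD_meas {n : ℕ} (f : En n → ℂ) : Measurable (radD f) := by
  have h1 : Measurable (fun z => (fderiv ℂ f z, z)) := (measurable_fderiv ℂ f).prodMk measurable_id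
  have h2 : Continuous (fun p : (En n →L[ℂ] ℂ) × En n => p.1 p.2) := by fun_prop
  exact h2.measurable.comp h1

lemma aux_mem_D' {n : ℕ} {z w : En n} {γ : ℝ} (hγ : 0 < γ) (hz : z ∈ uball n) (hw : w ∈ uball n) :
    w ∈ Dball z γ ↔ (1 - Rg γ ^ 2) * ‖1 - inner ℂ z w‖ ^ 2 < (1 - ‖z‖ ^ 2) * (1 - ‖w‖ ^ 2) := by
  rw [aux_mem_D hz hw]
  have h := aux_mob_norm hz hw
  have hR := aux_Rg hγ
  have hz1 := aux_ub.1 hz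
  have h1 : 0 < ‖1 - inner ℂ z w‖ := by have := (aux_inner_ne hz hw).1; linarith
  rw [← pow_lt_pow_iff_left₀ (norm_nonneg _) hR.1.le two_ne_zero,
    ← mul_lt_mul_iff_left₀ (pow_pos h1 2), h]
  constructor <;> intro h <;> linarith

lemma aux_D_open {n : ℕ} {γ : ℝ} (hγ : 0 < γ) :
    IsOpen {x : En n × En n | x.1 ∈ uball n ∧ x.2 ∈ Dball x.1 γ} := by
  have : {x : En n × En n | x.1 ∈ uball n ∧ x.2 ∈ Dball x.1 γ} = {x : En n × En n | x.1 ∈ uball n} ∩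
    ({x : En n × En n | x.2 ∈ uball n} ∩ {x : En n × En n | (1 - Rg γ ^ 2) * ‖1 - inner ℂ x.1 x.2‖ ^ 2 <
      (1 - ‖x.1‖ ^ 2) * (1 - ‖x.2‖ ^ 2)}) := by
    ext ⟨z, w⟩
    simp only [Set.mem_setOf_eq, Set.mem_inter_iff]
    constructor
    · rintro ⟨h1, h2⟩
      exact ⟨h1, h2.1, (aux_mem_D' hγ h1 h2.1).1 h2⟩
    · rintro ⟨h1, h2, h3⟩
      exact ⟨h1, (aux_mem_D' hγ h1 h2).2 h3⟩
  rw [this]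
  refine IsOpen.inter (Metric.isOpen_ball.preimage continuous_fst)
    (IsOpen.inter (Metric.isOpen_ball.preimage continuous_snd) (isOpen_lt ?_ ?_)) <;> fun_prop

lemma aux_D_meas {n : ℕ} {γ : ℝ} (hγ : 0 < γ) {z : En n} (hz : z ∈ uball n) :
    MeasurableSet (Dball z γ) := by
  have : Dball z γ = (fun w => (z, w)) ⁻¹' {x : En n × En n | x.1 ∈ uball n ∧ x.2 ∈ Dball x.1 γ} := by
    ext w; simp [hz]
  rw [this]
  exact ((aux_D_open hγ).preimage (by fun_prop)).measurableSet

lemma aux_area_meas {n : ℕ} {γ : ℝ} (hγ : 0 < γ) {g : En n → ℝ≥0∞} (hg : Measurable g) :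
    ∃ A : En n → ℝ≥0∞, Measurable A ∧ ∀ z ∈ uball n, A z = ∫⁻ w in Dball z γ, g w ∂measTau n := by
  set E := {x : En n × En n | x.1 ∈ uball n ∧ x.2 ∈ Dball x.1 γ}
  refine ⟨fun z => ∫⁻ w, E.indicator (fun x => g x.2) (z, w) ∂measTau n, ?_, ?_⟩
  · refine Measurable.lintegral_prod_right' (f := E.indicator (fun x => g x.2)) ?_
    exact (hg.comp measurable_snd).indicator (aux_D_open hγ).measurableSet
  · intro z hz
    rw [← lintegral_indicator (aux_D_meas hγ hz)]
    apply lintegral_congr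
    intro w
    by_cases hw : w ∈ Dball z γ
    · rw [Set.indicator_of_mem hw, Set.indicator_of_mem]; exact ⟨hz, hw⟩
    · rw [Set.indicator_of_notMem hw, Set.indicator_of_notMem]; exact fun h => hw h.2


lemma aux_inv_eq {n : ℕ} {f : En n → ℂ} (hf : DifferentiableOn ℂ f (uball n)) {w : En n}
    (hw : w ∈ uball n) : invGradArea f w = ‖(fderiv ℂ f w).comp (Tz w)‖ := by
  have h0 : mobius w 0 = w := by rw [aux_mob]; simp
  have hfd : HasFDerivAt f (fderiv ℂ f w) (mobius w 0) := by
    rw [h0]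
    exact (hf.differentiableAt (Metric.isOpen_ball.mem_nhds hw)).hasFDerivAt
  have := hfd.comp (0 : En n) (aux_mob_deriv w hw)
  rw [invGradArea, this.fderiv, ContinuousLinearMap.comp_neg, norm_neg]

lemma aux_grad_le {n : ℕ} {f : En n → ℂ} (hf : DifferentiableOn ℂ f (uball n)) {w : En n}
    (hw : w ∈ uball n) : gradArea f w ≤ invGradArea f w := by
  rw [aux_inv_eq hf hw, gradArea, ← aux_s_sq hw]
  have hs := aux_s_pos hw
  have h1 := aux_s_le (z := w)
  rw [← le_div_iff₀' (by positivity)]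
  refine ContinuousLinearMap.opNorm_le_bound _ (by positivity) ?_
  intro u
  rw [div_mul_eq_mul_div, le_div_iff₀' (by positivity)]
  set x : En n := (1 : ℂ) • Pj w u + ((sz w : ℝ) : ℂ) • (u - Pj w u) with hx
  have hxn : ‖x‖ ≤ ‖u‖ := by
    refine (pow_le_pow_iff_left₀ (norm_nonneg _) (by positivity) two_ne_zero).1 ?_
    rw [hx, aux_pyth, aux_pyth1 w u, Complex.norm_real, Real.norm_of_nonneg hs.le]
    have : sz w ^ 2 ≤ 1 := by nlinarith
    simp only [norm_one, one_pow, one_mul]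
    nlinarith [sq_nonneg ‖u - Pj w u‖]
  have hPx : Pj w x = Pj w u := by
    rw [hx, map_add, map_smul, map_smul, map_sub, aux_Pj_idem, sub_self, smul_zero, add_zero, one_smul]
  have hT : Tz w x = ((sz w ^ 2 : ℝ) : ℂ) • u := by
    rw [aux_T_apply, hPx, hx]
    push_cast
    module
  have := ((fderiv ℂ f w).comp (Tz w)).le_opNorm x
  rw [ContinuousLinearMap.comp_apply, hT, map_smul, norm_smul, Complex.norm_real,
    Real.norm_of_nonneg (by positivity)] at this
  exact this.trans (by gcongr)

lemma aux_rad_le {n : ℕ} {f : En n → ℂ} {w : En n}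
    (hw : w ∈ uball n) : radArea f w ≤ gradArea f w := by
  have hw1 := aux_ub.1 hw
  rw [radArea, gradArea]
  have : 0 ≤ 1 - ‖w‖ ^ 2 := by nlinarith [norm_nonneg w]
  gcongr
  rw [radD]
  refine ((fderiv ℂ f w).le_opNorm w).trans ?_
  nlinarith [norm_nonneg (fderiv ℂ f w)]

lemma aux_areaF_mono {n : ℕ} {γ q : ℝ} (hγ : 0 < γ) (hq : 1 < q) {g h : En n → ℝ} (hgh : ∀ w ∈ uball n, g w ≤ h w)
    {z : En n} (hz : z ∈ uball n) : areaF γ q g z ≤ areaF γ q h z := by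
  unfold areaF
  refine ENNReal.rpow_le_rpow ?_ (by positivity)
  refine setLIntegral_mono' (aux_D_meas hγ hz) ?_
  intro w hw
  exact ENNReal.rpow_le_rpow (ENNReal.ofReal_le_ofReal (hgh w hw.1)) (by positivity)

lemma aux_inv_cauchy {n : ℕ} {f : En n → ℂ} (hf : DifferentiableOn ℂ f (uball n)) {w : En n}
    (hw : w ∈ uball n) {B : ℝ} (hB : ∀ y : En n, ‖y‖ ≤ 1 / 16 → ‖f (w + Tz w y)‖ ≤ B) :
    invGradArea f w ≤ 16 * B := by
  rw [aux_inv_eq hf hw]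
  have hB0 : 0 ≤ B := (norm_nonneg _).trans (hB 0 (by simp))
  refine ContinuousLinearMap.opNorm_le_bound _ (by positivity) ?_
  intro x
  by_cases hx : x = 0
  · simp [hx]
  have hxn : 0 < ‖x‖ := norm_pos_iff.2 hx
  set R : ℝ := (1 / 16) / ‖x‖ with hR
  have hRp : 0 < R := by positivity
  have hmem : ∀ l : ℂ, ‖l‖ ≤ R → ‖l • x‖ ≤ 1 / 16 := by
    intro l hl
    rw [norm_smul]
    rwa [hR, le_div_iff₀ hxn] at hl
  have hda : ∀ l : ℂ, ‖l‖ ≤ R → DifferentiableAt ℂ (fun l : ℂ => f (w + l • Tz w x)) l := by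
    intro l hl
    have h1 : w + l • Tz w x ∈ uball n := by
      rw [← map_smul]
      exact aux_psi_mem hw ((hmem l hl).trans (by norm_num))
    have h2 := hf.differentiableAt (Metric.isOpen_ball.mem_nhds h1)
    exact DifferentiableAt.comp (x := l) (f := fun l : ℂ => w + l • Tz w x) h2 (by fun_prop)
  have hd : HasDerivAt (fun l : ℂ => f (w + l • Tz w x)) (fderiv ℂ f w (Tz w x)) 0 := by
    have h2 : HasFDerivAt f (fderiv ℂ f w) (w + (0:ℂ) • Tz w x) := by
      simpa using (hf.differentiableAt (Metric.isOpen_ball.mem_nhds hw)).hasFDerivAt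
    have h3 : HasDerivAt (fun l : ℂ => w + l • Tz w x) (Tz w x) 0 := by
      simpa using ((hasDerivAt_id (0 : ℂ)).smul_const (Tz w x)).const_add w
    exact h2.comp_hasDerivAt (0 : ℂ) h3
  have := Complex.norm_deriv_le_of_forall_mem_sphere_norm_le (f := fun l : ℂ => f (w + l • Tz w x)) (c := 0)
    (R := R) (C := B) hRp ?_ ?_
  · rw [hd.deriv] at this
    rw [ContinuousLinearMap.comp_apply]
    refine this.trans (le_of_eq ?_)
    rw [hR]; field_simp
  · refine DifferentiableOn.diffContOnCl ?_
    rw [closure_ball _ hRp.ne']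
    intro l hl
    exact (hda l (by simpa using hl)).differentiableWithinAt
  · intro l hl
    have := hB (l • x) (hmem l (by simpa using (mem_sphere_iff_norm.1 hl).le))
    simpa using this

lemma aux_relQ_rpow {n : ℕ} {K : ℝ} (hK : 1 ≤ K) {z w : En n} (hz : z ∈ uball n) (hw : w ∈ uball n)
    (h : relQ K z w) (b : ℝ) : (1 - ‖z‖ ^ 2) ^ b ≤ (4 * K) ^ |b| * (1 - ‖w‖ ^ 2) ^ b := by
  have h1 := aux_relQ_comp hz hw h
  have h2 := aux_relQ_comp hw hz (aux_relQ_symm h)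
  have hz1 := aux_s_sq hz
  have hw1 := aux_s_sq hw
  have hz2 := aux_s_pos hz
  have hw2 := aux_s_pos hw
  rw [← hz1, ← hw1] at h1 h2 ⊢
  rcases le_total 0 b with hb | hb
  · rw [abs_of_nonneg hb, ← Real.mul_rpow (by positivity) (by positivity)]
    exact Real.rpow_le_rpow (by positivity) h2 hb
  · rw [abs_of_nonpos hb, Real.rpow_neg (by positivity), ← div_eq_inv_mul, le_div_iff₀' (by positivity),
      ← Real.mul_rpow (by positivity) (by positivity)]
    exact Real.rpow_le_rpow_of_nonpos (by positivity) h1 hb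

lemma aux_relQ_meas {n : ℕ} (K : ℝ) : MeasurableSet {x : En n × En n | relQ K x.1 x.2} := by
  unfold relQ
  apply measurableSet_le <;> exact Continuous.measurable (by fun_prop)

lemma aux_relQ_int {n : ℕ} {K : ℝ} (hK : 1 ≤ K) {w : En n} (hw : w ∈ uball n) (b : ℝ) :
    ∫⁻ z in uball n, {z | relQ K z w}.indicator (fun z => ENNReal.ofReal ((1 - ‖z‖ ^ 2) ^ b)) z ∂vol n ≤
      ENNReal.ofReal ((4 * K) ^ |b|) * vol n (Metric.ball 0 (9 * K)) *
        ENNReal.ofReal ((1 - ‖w‖ ^ 2) ^ (b + (n + 1))) := by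
  have hm : MeasurableSet {z : En n | relQ K z w} := by
    have := (aux_relQ_meas (n := n) K).preimage (f := fun z => (z, w)) (by fun_prop)
    exact this
  have hpos : 0 < 1 - ‖w‖ ^ 2 := by rw [← aux_s_sq hw]; exact pow_pos (aux_s_pos hw) 2
  rw [lintegral_indicator hm, Measure.restrict_restrict hm]
  calc ∫⁻ z in {z | relQ K z w} ∩ uball n, ENNReal.ofReal ((1 - ‖z‖ ^ 2) ^ b) ∂vol n
      ≤ ∫⁻ z in {z | relQ K z w} ∩ uball n, ENNReal.ofReal ((4 * K) ^ |b| * (1 - ‖w‖ ^ 2) ^ b) ∂vol n := by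
        refine setLIntegral_mono' (hm.inter (aux_uball_meas n)) ?_
        intro z hz
        exact ENNReal.ofReal_le_ofReal (aux_relQ_rpow hK hz.2 hw hz.1 b)
    _ = ENNReal.ofReal ((4 * K) ^ |b| * (1 - ‖w‖ ^ 2) ^ b) * vol n ({z | relQ K z w} ∩ uball n) := by
        rw [setLIntegral_const]
    _ ≤ ENNReal.ofReal ((4 * K) ^ |b| * (1 - ‖w‖ ^ 2) ^ b) *
        (ENNReal.ofReal ((1 - ‖w‖ ^ 2) ^ (n + 1)) * vol n (Metric.ball 0 (9 * K))) := by
        gcongr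
        refine le_trans (measure_mono ?_) (aux_relQ_vol hK hw)
        intro z hz
        exact ⟨hz.2, hz.1⟩
    _ = _ := by
        have e : ((n : ℝ) + 1) = ((n + 1 : ℕ) : ℝ) := by push_cast; ring
        rw [Real.rpow_add hpos, e, Real.rpow_natCast, ENNReal.ofReal_mul (by positivity), ENNReal.ofReal_mul (by positivity)]
        ring

lemma aux_tau_D {n : ℕ} {γ : ℝ} (hγ : 0 < γ) :
    ∃ C : ℝ≥0∞, C < ⊤ ∧ ∀ z ∈ uball n, measTau n (Dball z γ) ≤ C := by
  have hR := aux_Rg hγ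
  set K := (1 - Rg γ ^ 2)⁻¹
  have hK : 1 ≤ K := by rw [one_le_inv₀] <;> nlinarith
  refine ⟨ENNReal.ofReal ((4 * K) ^ |(-((n : ℝ) + 1))|) * vol n (Metric.ball 0 (9 * K)) *
        ENNReal.ofReal 1, ?_, ?_⟩
  · exact ENNReal.mul_lt_top (ENNReal.mul_lt_top ENNReal.ofReal_lt_top measure_ball_lt_top) ENNReal.ofReal_lt_top
  · intro z hz
    have h := aux_relQ_int hK hz (-((n : ℝ) + 1))
    rw [neg_add_cancel, Real.rpow_zero] at h
    refine le_trans ?_ h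
    rw [← setLIntegral_one, aux_tau_set (aux_D_meas hγ hz) measurable_const, ← lintegral_indicator (aux_uball_meas n)]
    apply lintegral_mono
    intro w
    by_cases hw : w ∈ Dball z γ
    · have h1 : w ∈ {w | relQ K w z} := aux_relQ_symm (aux_D_out hγ hz hw)
      simp [Set.indicator_of_mem hw.1, Set.indicator_of_mem h1, hw, hw.1]
    · rw [Set.indicator_of_notMem]
      · simp
      · exact fun h => hw h.2


lemma aux_ind_meas {n : ℕ} {f : En n → ℂ} (hf : DifferentiableOn ℂ f (uball n)) :
    Measurable ((uball n).indicator f) := by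
  have h := hf.continuousOn
  rw [← Set.piecewise_eq_indicator]
  exact h.measurable_piecewise continuousOn_const (aux_uball_meas n)

lemma aux_ind_line {n : ℕ} {f : En n → ℂ} (hf : DifferentiableOn ℂ f (uball n)) (z x : En n) (l : ℂ)
    (hl : z + l • x ∈ uball n) : DifferentiableAt ℂ (fun l : ℂ => (uball n).indicator f (z + l • x)) l := by
  have h2 : DifferentiableAt ℂ ((uball n).indicator f) (z + l • x) := by
    have h3 := hf.differentiableAt (Metric.isOpen_ball.mem_nhds hl)
    refine h3.congr_of_eventuallyEq ?_
    filter_upwards [Metric.isOpen_ball.mem_nhds hl] with y hy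
    exact Set.indicator_of_mem hy f
  exact DifferentiableAt.comp (x := l) (f := fun l : ℂ => z + l • x) h2 (by fun_prop)

lemma aux_vol_pos {n : ℕ} {δ : ℝ} (hδ : 0 < δ) : 0 < vol n (Metric.ball 0 δ) :=
  Metric.measure_ball_pos _ _ hδ

lemma aux_up_point {n : ℕ} {p : ℝ} (hp : 0 < p) : ∃ C : ℝ≥0∞, C < ⊤ ∧
    ∀ f : En n → ℂ, DifferentiableOn ℂ f (uball n) → ∀ w ∈ uball n, ∀ S : Set (En n), MeasurableSet S →
      (∀ x, ‖x‖ < 1 / 8 → w + Tz w x ∈ S) →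
      ENNReal.ofReal (invGradArea f w) ^ p ≤
        C * ∫⁻ y in S, ENNReal.ofReal (‖(uball n).indicator f y‖ ^ p) ∂measTau n := by
  set v := vol n (Metric.ball (0 : En n) (1 / 16)) with hv
  have hv0 : v ≠ 0 := (aux_vol_pos (by norm_num)).ne'
  have hvt : v ≠ ⊤ := measure_ball_lt_top.ne
  refine ⟨ENNReal.ofReal (16 ^ p) * (v⁻¹ * 2 ^ (n + 1)), ?_, ?_⟩
  · exact ENNReal.mul_lt_top ENNReal.ofReal_lt_top (ENNReal.mul_lt_top (ENNReal.inv_lt_top.2 (pos_iff_ne_zero.2 hv0))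
      (by finiteness))
  intro f hf w hw S hS hSsub
  set g := (uball n).indicator f with hg
  have hgm : Measurable g := aux_ind_meas hf
  set h : En n → ℝ≥0∞ := fun y => ENNReal.ofReal (‖g y‖ ^ p) with hh
  have hhm : Measurable h := (hgm.norm.pow_const p).ennreal_ofReal
  set I := ∫⁻ y in S, h y ∂measTau n with hI
  have key : ∀ y : En n, ‖y‖ ≤ 1 / 16 → h (w + Tz w y) ≤ v⁻¹ * 2 ^ (n + 1) * I := by
    intro y hy
    have h1 := aux_submean_ell hgm (p := p) (δ := 1 / 16) hp (by norm_num) hw (y := y) (by linarith) (aux_ind_line hf)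
    have h2 : ∫⁻ x in Metric.ball 0 (1 / 16), h (w + Tz w (y + x)) ∂vol n ≤
        ∫⁻ x in Metric.ball 0 (1 / 8), h (w + Tz w x) ∂vol n := by
      rw [← lintegral_indicator measurableSet_ball, ← lintegral_indicator measurableSet_ball]
      rw [← lintegral_add_left_eq_self ((Metric.ball (0 : En n) (1 / 8)).indicator fun x => h (w + Tz w x)) y]
      apply lintegral_mono
      intro x
      by_cases hx : x ∈ Metric.ball (0 : En n) (1 / 16)
      · have : y + x ∈ Metric.ball (0 : En n) (1 / 8) := by
          rw [mem_ball_zero_iff] at *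
          exact (norm_add_le _ _).trans_lt (by linarith)
        rw [Set.indicator_of_mem hx]; beta_reduce; rw [Set.indicator_of_mem this]
      · rw [Set.indicator_of_notMem hx]; exact zero_le
    have h3 := aux_cov hw (le_refl (1 / 8 : ℝ)) hS hSsub hhm
    have h4 := (h1.trans h2).trans h3
    rw [mul_assoc, ← ENNReal.mul_le_iff_le_inv hv0 hvt]
    exact h4
  by_cases hIt : v⁻¹ * 2 ^ (n + 1) * I = ⊤
  · rw [mul_assoc, hIt, ENNReal.mul_top]
    · exact le_top
    · have : (0 : ℝ) < 16 ^ p := by positivity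
      simpa using this
  set B : ℝ := (v⁻¹ * 2 ^ (n + 1) * I).toReal ^ (1 / p) with hB
  have hinv := aux_inv_cauchy hf hw (B := B) (by
    intro y hy
    have h1 := key y hy
    have hm : w + Tz w y ∈ uball n := aux_psi_mem hw (hy.trans (by norm_num))
    simp only [hh, hg, Set.indicator_of_mem hm] at h1
    rw [ENNReal.ofReal_le_iff_le_toReal hIt] at h1
    rw [hB, one_div]
    exact (Real.le_rpow_inv_iff_of_pos (norm_nonneg _) ENNReal.toReal_nonneg hp).2 h1)
  have hB0 : 0 ≤ B := by positivity
  calc ENNReal.ofReal (invGradArea f w) ^ p ≤ ENNReal.ofReal (16 * B) ^ p := by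
        gcongr
    _ = ENNReal.ofReal (16 ^ p) * (v⁻¹ * 2 ^ (n + 1) * I) := by
        rw [ENNReal.ofReal_rpow_of_nonneg (by positivity) hp.le, Real.mul_rpow (by norm_num) hB0, hB,
          ← Real.rpow_mul ENNReal.toReal_nonneg, one_div_mul_cancel hp.ne', Real.rpow_one, ENNReal.ofReal_mul (by positivity),
          ENNReal.ofReal_toReal hIt]
    _ = _ := by ring

lemma aux_cnorm_pos {n : ℕ} {α : ℝ} (hα : -1 < α) : 0 < cnorm n α := by
  rw [cnorm, if_pos hα]
  have h1 : 0 < Real.Gamma (n + α + 1) := Real.Gamma_pos_of_pos (by have : (0:ℝ) ≤ n := n.cast_nonneg; linarith)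
  have h2 : 0 < Real.Gamma (α + 1) := Real.Gamma_pos_of_pos (by linarith)
  positivity

lemma aux_upper {n : ℕ} {γ q α p : ℝ} (hγ : 0 < γ) (hq : 1 < q) (hα : -1 < α) (hp : 0 < p) :
    ∃ C : ℝ≥0∞, C < ⊤ ∧ ∀ f : En n → ℂ, DifferentiableOn ℂ f (uball n) →
      (∫⁻ z, (areaF γ q (invGradArea f) z) ^ p ∂measA n α) ≤
        C * ∫⁻ z, ENNReal.ofReal (‖f z‖ ^ p) ∂measA n α := by
  obtain ⟨C1, hC1, H1⟩ := aux_up_point (n := n) hp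
  obtain ⟨C2, hC2, H2⟩ := aux_tau_D (n := n) hγ
  have hR := aux_Rg hγ
  set K := (1 - Rg γ ^ 2)⁻¹
  have hK : 1 ≤ K := by rw [one_le_inv₀] <;> nlinarith
  set K' := 72 * K ^ 3 with hK'
  have hK1 : 1 ≤ K' := by
    have : 1 ≤ K ^ 3 := one_le_pow₀ hK
    linarith
  set V := ENNReal.ofReal ((4 * K') ^ |α|) * vol n (Metric.ball 0 (9 * K')) with hV
  have hVt : V < ⊤ := ENNReal.mul_lt_top ENNReal.ofReal_lt_top measure_ball_lt_top
  have hp0 : (p / q) ≥ 0 := by positivity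
  have hVV : C2 ^ (p / q) < ⊤ := ENNReal.rpow_lt_top_of_nonneg hp0 hC2.ne
  refine ⟨C1 * C2 ^ (p / q) * V, by finiteness, ?_⟩
  intro f hf
  set g := (uball n).indicator f with hg
  have hgm : Measurable g := aux_ind_meas hf
  set h : En n → ℝ≥0∞ := fun y => ENNReal.ofReal (‖g y‖ ^ p) with hh
  have hhm : Measurable h := (hgm.norm.pow_const p).ennreal_ofReal
  set E := {x : En n × En n | relQ K' x.1 x.2} with hE
  have hEm : MeasurableSet E := aux_relQ_meas K'
  have hpt : ∀ z ∈ uball n, (areaF γ q (invGradArea f) z) ^ p ≤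
      C1 * C2 ^ (p / q) * ∫⁻ y, E.indicator (fun x => h x.2) (z, y) ∂measTau n := by
    intro z hz
    set S := {y | relQ K' z y} with hS
    have hSm : MeasurableSet S := hEm.preimage (f := fun y => (z, y)) (by fun_prop)
    have hI : ∫⁻ y, E.indicator (fun x => h x.2) (z, y) ∂measTau n = ∫⁻ y in S, h y ∂measTau n := by
      rw [← lintegral_indicator hSm]; rfl
    rw [hI]
    set I := ∫⁻ y in S, h y ∂measTau n
    have hb : ∀ w ∈ Dball z γ, ENNReal.ofReal (invGradArea f w) ^ q ≤ (C1 * I) ^ (q / p) := by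
      intro w hw
      have h1 := H1 f hf w hw.1 S hSm (by
        intro x hx
        exact aux_relQ_tri hK hz hw.1 (aux_D_out hγ hz hw) hx.le)
      calc ENNReal.ofReal (invGradArea f w) ^ q = (ENNReal.ofReal (invGradArea f w) ^ p) ^ (q / p) := by
            rw [← ENNReal.rpow_mul]; congr 1; field_simp
        _ ≤ _ := by gcongr; 
    have h2 : ∫⁻ w in Dball z γ, ENNReal.ofReal (invGradArea f w) ^ q ∂measTau n ≤ (C1 * I) ^ (q / p) * C2 := by
      refine (setLIntegral_mono' (aux_D_meas hγ hz) hb).trans ?_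
      rw [setLIntegral_const]
      gcongr
      exact H2 z hz
    rw [areaF, ← ENNReal.rpow_mul]
    calc _ ≤ ((C1 * I) ^ (q / p) * C2) ^ (1 / q * p) := by gcongr
      _ = C1 * C2 ^ (p / q) * I := by
        rw [ENNReal.mul_rpow_of_nonneg _ _ (by positivity), ← ENNReal.rpow_mul]
        have e1 : q / p * (1 / q * p) = 1 := by field_simp
        have e2 : 1 / q * p = p / q := by ring
        rw [e1, e2, ENNReal.rpow_one]; ring
  have hindm : Measurable (E.indicator (fun x : En n × En n => h x.2)) := (hhm.comp measurable_snd).indicator hEm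
  calc (∫⁻ z, (areaF γ q (invGradArea f) z) ^ p ∂measA n α)
      ≤ ∫⁻ z, C1 * C2 ^ (p / q) * ∫⁻ y, E.indicator (fun x => h x.2) (z, y) ∂measTau n ∂measA n α := aux_A_mono hpt
    _ = C1 * C2 ^ (p / q) * ∫⁻ z, ∫⁻ y, E.indicator (fun x => h x.2) (z, y) ∂measTau n ∂measA n α := by
        rw [lintegral_const_mul]
        exact Measurable.lintegral_prod_right' (f := E.indicator (fun x : En n × En n => h x.2)) hindm
    _ = C1 * C2 ^ (p / q) * ∫⁻ y, ∫⁻ z, E.indicator (fun x => h x.2) (z, y) ∂measA n α ∂measTau n := by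
        rw [lintegral_lintegral_swap]
        exact hindm.aemeasurable
    _ ≤ C1 * C2 ^ (p / q) * (V * ∫⁻ z, h z ∂measA n α) := by
        gcongr
        have e1 : ∀ y ∈ uball n, ∫⁻ z, E.indicator (fun x => h x.2) (z, y) ∂measA n α ≤
            h y * (V * ENNReal.ofReal (cnorm n α * (1 - ‖y‖ ^ 2) ^ (α + (n + 1)))) := by
          intro y hy
          have hSm : MeasurableSet {z | relQ K' z y} := hEm.preimage (f := fun z => (z, y)) (by fun_prop)
          rw [aux_A_int (by exact hindm.comp measurable_prodMk_right)]
          have h3 := aux_relQ_int hK1 hy α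
          calc ∫⁻ z in uball n, ENNReal.ofReal (cnorm n α * (1 - ‖z‖ ^ 2) ^ α) * E.indicator (fun x => h x.2) (z, y) ∂vol n
              = ∫⁻ z in uball n, (ENNReal.ofReal (cnorm n α) * h y) *
                {z | relQ K' z y}.indicator (fun z => ENNReal.ofReal ((1 - ‖z‖ ^ 2) ^ α)) z ∂vol n := by
                apply lintegral_congr
                intro z
                rw [ENNReal.ofReal_mul (aux_cnorm_pos hα).le]
                by_cases hz : relQ K' z y
                · have hz1 : (z, y) ∈ E := hz
                  have hz2 : z ∈ {z | relQ K' z y} := hz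
                  rw [Set.indicator_of_mem hz1, Set.indicator_of_mem hz2]; ring
                · have hz1 : (z, y) ∉ E := hz
                  have hz2 : z ∉ {z | relQ K' z y} := hz
                  rw [Set.indicator_of_notMem hz1, Set.indicator_of_notMem hz2]; simp
            _ = (ENNReal.ofReal (cnorm n α) * h y) * ∫⁻ z in uball n, 
                {z | relQ K' z y}.indicator (fun z => ENNReal.ofReal ((1 - ‖z‖ ^ 2) ^ α)) z ∂vol n := by
                rw [lintegral_const_mul]
                exact Measurable.indicator (by fun_prop) hSm
            _ ≤ (ENNReal.ofReal (cnorm n α) * h y) * (V * ENNReal.ofReal ((1 - ‖y‖ ^ 2) ^ (α + (n + 1)))) := by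
                gcongr
            _ = _ := by rw [ENNReal.ofReal_mul (aux_cnorm_pos hα).le]; ring
        have e2 : ∀ G : En n → ℝ≥0∞, Measurable G → ∫⁻ y, G y ∂measTau n =
            ∫⁻ y in uball n, ENNReal.ofReal ((1 - ‖y‖ ^ 2) ^ (-((n : ℝ) + 1))) * G y ∂vol n := by
          intro G hG
          have := aux_tau_set (n := n) MeasurableSet.univ hG
          rw [Measure.restrict_univ, Set.inter_univ, lintegral_indicator (aux_uball_meas n)] at this
          exact this
        have hmI : Measurable (fun y => ∫⁻ z, E.indicator (fun x => h x.2) (z, y) ∂measA n α) :=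
          Measurable.lintegral_prod_left' (f := E.indicator (fun x : En n × En n => h x.2)) hindm
        rw [e2 _ hmI, aux_A_int hhm, ← lintegral_const_mul V (show Measurable (fun w => ENNReal.ofReal (cnorm n α * (1 - ‖w‖ ^ 2) ^ α) * h w) from (aux_dens_A n α).mul hhm)]
        refine setLIntegral_mono' (aux_uball_meas n) ?_
        intro y hy
        have hpos : 0 < 1 - ‖y‖ ^ 2 := by rw [← aux_s_sq hy]; exact pow_pos (aux_s_pos hy) 2
        calc _ ≤ ENNReal.ofReal ((1 - ‖y‖ ^ 2) ^ (-((n : ℝ) + 1))) *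
              (h y * (V * ENNReal.ofReal (cnorm n α * (1 - ‖y‖ ^ 2) ^ (α + (n + 1))))) := by
              gcongr; exact e1 y hy
          _ = V * ((ENNReal.ofReal ((1 - ‖y‖ ^ 2) ^ (-((n : ℝ) + 1))) * ENNReal.ofReal (cnorm n α * (1 - ‖y‖ ^ 2) ^ (α + (n + 1)))) * h y) := by ring
          _ = _ := by
            rw [← ENNReal.ofReal_mul (by positivity)]
            congr 3
            rw [mul_left_comm, ← Real.rpow_add hpos]
            congr 2; ring
    _ = C1 * C2 ^ (p / q) * V * ∫⁻ z, h z ∂measA n α := by ring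
    _ = _ := by
        congr 1
        apply aux_A_congr
        intro z hz
        simp [hh, hg, Set.indicator_of_mem hz]


lemma aux_ball_A {n : ℕ} {α : ℝ} (hα : -1 < α) : ∃ C : ℝ≥0∞, C < ⊤ ∧ ∀ h : En n → ℝ≥0∞, Measurable h →
    ∫⁻ z in Metric.ball 0 (3 / 4), h z ∂vol n ≤ C * ∫⁻ z, h z ∂measA n α := by
  have hc := aux_cnorm_pos (n := n) hα
  set m : ℝ := cnorm n α * (1 / 4) ^ |α| with hm
  have hm0 : 0 < m := by positivity
  refine ⟨ENNReal.ofReal m⁻¹, ENNReal.ofReal_lt_top, ?_⟩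
  intro h hh
  rw [aux_A_int hh, ← lintegral_const_mul _ (show Measurable (fun w : En n => ENNReal.ofReal (cnorm n α * (1 - ‖w‖ ^ 2) ^ α) * h w) from (aux_dens_A n α).mul hh)]
  calc ∫⁻ z in Metric.ball 0 (3 / 4), h z ∂vol n
      ≤ ∫⁻ z in Metric.ball 0 (3 / 4), ENNReal.ofReal m⁻¹ * (ENNReal.ofReal (cnorm n α * (1 - ‖z‖ ^ 2) ^ α) * h z) ∂vol n := by
        refine setLIntegral_mono' measurableSet_ball ?_
        intro z hz
        rw [mem_ball_zero_iff] at hz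
        rw [← mul_assoc, ← ENNReal.ofReal_mul (by positivity)]
        have h1 : 1 / 4 ≤ 1 - ‖z‖ ^ 2 := by nlinarith [norm_nonneg z]
        have h2 : 1 - ‖z‖ ^ 2 ≤ 1 := by nlinarith [norm_nonneg z]
        have h3 : (1 / 4 : ℝ) ^ |α| ≤ (1 - ‖z‖ ^ 2) ^ α := by
          calc (1 / 4 : ℝ) ^ |α| ≤ (1 - ‖z‖ ^ 2) ^ |α| := Real.rpow_le_rpow (by norm_num) h1 (abs_nonneg _)
            _ ≤ _ := Real.rpow_le_rpow_of_exponent_ge (by linarith) h2 (le_abs_self α)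
        have : 1 ≤ m⁻¹ * (cnorm n α * (1 - ‖z‖ ^ 2) ^ α) := by
          rw [← div_eq_inv_mul, one_le_div hm0, hm]; gcongr
        calc h z = 1 * h z := (one_mul _).symm
          _ ≤ _ := by
            gcongr
            rw [ENNReal.one_le_ofReal]; exact this
    _ ≤ _ := lintegral_mono_set (Metric.ball_subset_ball (by norm_num))

lemma aux_f0 {n : ℕ} {α p : ℝ} (hα : -1 < α) (hp : 0 < p) : ∃ C : ℝ≥0∞, C < ⊤ ∧ ∀ f : En n → ℂ,
    DifferentiableOn ℂ f (uball n) → ENNReal.ofReal ‖f 0‖ ^ p ≤ C * ∫⁻ z, ENNReal.ofReal (‖f z‖ ^ p) ∂measA n α := by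
  obtain ⟨C, hC, H⟩ := aux_ball_A (n := n) hα
  set v := vol n (Metric.ball (0 : En n) (3 / 4)) with hv
  have hv0 : v ≠ 0 := (aux_vol_pos (by norm_num)).ne'
  have hvt : v ≠ ⊤ := measure_ball_lt_top.ne
  refine ⟨v⁻¹ * C, ENNReal.mul_lt_top (ENNReal.inv_lt_top.2 (pos_iff_ne_zero.2 hv0)) hC, ?_⟩
  intro f hf
  have h1 := aux_submean_ball (aux_ind_meas hf) (r := 3 / 4) hp (by
    intro x l hl
    have := aux_ind_line hf 0 x l (by rw [zero_add, aux_ub]; linarith)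
    simpa using this)
  have h2 := H _ ((aux_ind_meas hf).norm.pow_const p).ennreal_ofReal
  have h3 := h1.trans h2
  rw [ENNReal.mul_le_iff_le_inv hv0 hvt, Set.indicator_of_mem (by rw [aux_ub]; simp)] at h3
  rw [ENNReal.ofReal_rpow_of_nonneg (norm_nonneg _) hp.le]
  refine h3.trans (le_of_eq ?_)
  rw [mul_assoc]
  congr 2
  apply aux_A_congr
  intro z hz
  rw [Set.indicator_of_mem hz]

lemma aux_low_geom {n : ℕ} {γ : ℝ} (hγ : 0 < γ) {u z x : En n} (hu : u ∈ uball n) (hz : z ∈ uball n)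
    (huz : ‖z - u‖ ≤ Rg γ / 48 * (1 - ‖u‖ ^ 2)) (hx : ‖x‖ < Rg γ / 48) : u + Tz u x ∈ Dball z γ := by
  have hR := aux_Rg hγ
  set δ := Rg γ / 48 with hδ
  have hδ0 : 0 < δ := div_pos hR.1 (by norm_num)
  have hδ1 : δ < 1 / 48 := by rw [hδ]; linarith
  have hsu := aux_s_pos hu
  have hsz := aux_s_pos hz
  have hsu2 := aux_s_sq hu
  have hsz2 := aux_s_sq hz
  have hsu1 := aux_s_le (z := u)
  have hu1 := aux_ub.1 hu
  have hz1 := aux_ub.1 hz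
  rw [← hsu2] at huz
  have hsq : 0 < sz u ^ 2 := by positivity
  have hcmp : sz u ^ 2 ≤ 2 * sz z ^ 2 := by
    have h1 : ‖z‖ ≤ ‖u‖ + ‖z - u‖ := by
      have := norm_add_le u (z - u)
      simpa using this
    rw [hsu2, hsz2]
    rw [hsu2] at huz hsq
    have h2 : ‖z‖ ^ 2 ≤ ‖u‖ ^ 2 + 2 * ‖z - u‖ := by
      have a1 := mul_nonneg (sub_nonneg.2 h1) (add_nonneg (norm_nonneg z) (norm_nonneg u))
      have a2 := mul_nonneg (norm_nonneg (z - u)) (show 0 ≤ 2 - ‖z‖ - ‖u‖ by linarith)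
      nlinarith
    have h3 := mul_lt_mul_of_pos_right hδ1 hsq
    linarith
  have hcmp1 : sz u ≤ 2 * sz z := by
    refine (pow_le_pow_iff_left₀ hsu.le (by positivity) two_ne_zero).1 ?_
    nlinarith
  have hTn : ‖Tz u x‖ ≤ δ * sz u := by
    refine (aux_T_norm hu x).trans ?_
    nlinarith
  have hw : u + Tz u x ∈ uball n := aux_psi_mem hu (by linarith)
  have hd : z - (u + Tz u x) = (z - u) - Tz u x := by abel
  have hdn : ‖z - (u + Tz u x)‖ ≤ 2 * δ * sz u := by
    rw [hd]
    refine (norm_sub_le _ _).trans ?_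
    nlinarith [mul_nonneg hδ0.le hsu.le]
  refine aux_D_in (δ := 6 * δ) hz hw ?_ ?_ (by rw [hδ]; linarith)
  · by_cases hzq : 1 / 4 ≤ ‖z‖
    · have e : z - (u + Tz u x) = (z - u) - ((((sz u) ^ 2 : ℝ) : ℂ) • Pj u x + ((sz u : ℝ) : ℂ) • (x - Pj u x)) := by
        rw [hd, aux_T_apply]
      have hPQ : ‖Pj z (x - Pj u x)‖ ≤ 4 * (δ * δ * sz u ^ 2) := by
        rw [aux_Pj_apply, norm_smul, norm_div, Complex.norm_real, Real.norm_of_nonneg (by positivity)]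
        have e1 : inner ℂ z (x - Pj u x) = inner ℂ (z - u) (x - Pj u x) := by
          have := aux_inner_PQ u u x
          rw [aux_Pj_self] at this
          rw [inner_sub_left, this, sub_zero]
        rw [e1]
        have h2 : ‖inner ℂ (z - u) (x - Pj u x)‖ ≤ δ * sz u ^ 2 * δ := by
          refine (norm_inner_le_norm _ _).trans ?_
          have := (aux_Q_le u x).trans hx.le
          gcongr
        have hzp : 0 < ‖z‖ := by linarith
        rw [div_mul_eq_mul_div, div_le_iff₀ (by positivity), pow_two ‖z‖, ← mul_assoc]
        gcongr
        refine h2.trans ?_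
        have : 0 < δ * δ * sz u ^ 2 := by positivity
        nlinarith
      rw [e, map_sub, map_add, map_smul, map_smul]
      have n1 : ‖Pj z (z - u)‖ ≤ δ * sz u ^ 2 := (aux_P_le _ _).trans huz
      have n2 : ‖(((sz u) ^ 2 : ℝ) : ℂ) • Pj z (Pj u x)‖ ≤ sz u ^ 2 * δ := by
        rw [norm_smul, Complex.norm_real, Real.norm_of_nonneg (by positivity)]
        gcongr
        exact (aux_P_le _ _).trans ((aux_P_le _ _).trans hx.le)
      have n3 : ‖((sz u : ℝ) : ℂ) • Pj z (x - Pj u x)‖ ≤ δ * sz u ^ 2 := by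
        rw [norm_smul, Complex.norm_real, Real.norm_of_nonneg hsu.le]
        have h5 : 0 < δ * sz u ^ 2 := by positivity
        have h6 : 4 * (δ * δ * sz u ^ 2) ≤ δ * sz u ^ 2 := by nlinarith
        nlinarith [norm_nonneg (Pj z (x - Pj u x))]
      refine (norm_sub_le _ _).trans ?_
      have h7 := norm_add_le ((((sz u) ^ 2 : ℝ) : ℂ) • Pj z (Pj u x)) (((sz u : ℝ) : ℂ) • Pj z (x - Pj u x))
      have a1 := mul_le_mul_of_nonneg_left hcmp hδ0.le
      linarith
    · push Not at hzq
      refine (aux_P_le _ _).trans (hdn.trans ?_)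
      have h15 : 15 / 16 ≤ sz z ^ 2 := by rw [hsz2]; nlinarith [norm_nonneg z]
      have a1 := mul_le_mul_of_nonneg_left hsu1 hδ0.le
      have a2 := mul_le_mul_of_nonneg_left h15 hδ0.le
      linarith
  · refine (aux_Q_le _ _).trans (hdn.trans ?_)
    have a1 := mul_le_mul_of_nonneg_left hcmp1 hδ0.le
    have a2 := mul_pos hδ0 hsz
    linarith

lemma aux_low_point {n : ℕ} {γ q : ℝ} (hγ : 0 < γ) (hq : 1 < q) : ∃ C : ℝ≥0∞, C < ⊤ ∧
    ∀ f : En n → ℂ, DifferentiableOn ℂ f (uball n) → ∀ u ∈ uball n, ∀ z ∈ uball n,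
      ‖z - u‖ ≤ Rg γ / 48 * (1 - ‖u‖ ^ 2) →
      ENNReal.ofReal (radArea f u) ≤ C * areaF γ q (radArea f) z := by
  have hR := aux_Rg hγ
  have hq0 : 0 < q := by linarith
  set δ := Rg γ / 48 with hδ
  have hδ0 : 0 < δ := div_pos hR.1 (by norm_num)
  have hδ1 : δ < 1 / 48 := by rw [hδ]; linarith
  set v := vol n (Metric.ball (0 : En n) δ) with hv
  have hv0 : v ≠ 0 := (aux_vol_pos hδ0).ne'
  have hvt : v ≠ ⊤ := measure_ball_lt_top.ne
  have hvi : v⁻¹ < ⊤ := ENNReal.inv_lt_top.2 (pos_iff_ne_zero.2 hv0)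
  set D := v⁻¹ * (2 ^ q * 2 ^ (n + 1)) with hD
  have hDt : D < ⊤ := by
    have : (2 : ℝ≥0∞) ^ q < ⊤ := ENNReal.rpow_lt_top_of_nonneg hq0.le (by norm_num)
    rw [hD]; finiteness
  refine ⟨D ^ (1 / q), ENNReal.rpow_lt_top_of_nonneg (by positivity) hDt.ne, ?_⟩
  intro f hf u hu z hz huz
  have hsu := aux_s_pos hu
  have hsu2 := aux_s_sq hu
  set h : En n → ℝ≥0∞ := fun w => ENNReal.ofReal (radArea f w) ^ q with hh
  have hhm : Measurable h := by
    have h1 := aux_radD_meas f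
    have : Measurable (radArea f) := by unfold radArea; fun_prop
    exact this.ennreal_ofReal.pow_const q
  have h1 := aux_submean_ell (aux_radD_meas f) (p := q) (δ := δ) hq0 (by linarith) hu (y := 0) (by simp; linarith)
    (fun z x l hl => aux_radD_line hf hl)
  simp only [map_zero, add_zero, zero_add] at h1
  have h2 := aux_cov hu (δ := δ) (by linarith) (aux_D_meas hγ hz) (fun x hx => aux_low_geom hγ hu hz huz hx) hhm
  have h3 : ENNReal.ofReal (sz u ^ 2) ^ q * ∫⁻ x in Metric.ball 0 δ, ENNReal.ofReal (‖radD f (u + Tz u x)‖ ^ q) ∂vol n ≤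
      2 ^ q * ∫⁻ x in Metric.ball 0 δ, h (u + Tz u x) ∂vol n := by
    have hTm : Measurable (fun x => u + Tz u x) := by have := (Tz u).continuous; fun_prop
    rw [← lintegral_const_mul, ← lintegral_const_mul]
    · refine setLIntegral_mono' measurableSet_ball ?_
      intro x hx
      rw [mem_ball_zero_iff] at hx
      have hps := (aux_psi hu (x := x) (by linarith)).1
      rw [hh]
      beta_reduce
      rw [← ENNReal.ofReal_rpow_of_nonneg (norm_nonneg _) hq0.le, ← ENNReal.mul_rpow_of_nonneg _ _ hq0.le,
        ← ENNReal.mul_rpow_of_nonneg _ _ hq0.le]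
      refine ENNReal.rpow_le_rpow ?_ hq0.le
      rw [← ENNReal.ofReal_mul (by positivity)]
      refine le_trans (ENNReal.ofReal_le_ofReal (q := 2 * radArea f (u + Tz u x)) ?_) (le_of_eq ?_)
      · rw [radArea, ← mul_assoc]
        gcongr
        linarith
      · rw [ENNReal.ofReal_mul (by norm_num)]; simp
    · exact hhm.comp hTm
    · exact (((aux_radD_meas f).comp hTm).norm.pow_const q).ennreal_ofReal
  have h4 : h u ≤ D * ∫⁻ w in Dball z γ, h w ∂measTau n := by
    rw [hD, mul_assoc, ← ENNReal.mul_le_iff_le_inv hv0 hvt]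
    calc v * h u = ENNReal.ofReal (sz u ^ 2) ^ q * (v * ENNReal.ofReal (‖radD f u‖ ^ q)) := by
          rw [hh]; beta_reduce
          rw [radArea, ← hsu2, ENNReal.ofReal_mul (by positivity), ENNReal.mul_rpow_of_nonneg _ _ hq0.le, 
            ENNReal.ofReal_rpow_of_nonneg (norm_nonneg _) hq0.le]; ring
      _ ≤ ENNReal.ofReal (sz u ^ 2) ^ q * ∫⁻ x in Metric.ball 0 δ, ENNReal.ofReal (‖radD f (u + Tz u x)‖ ^ q) ∂vol n := by gcongr
      _ ≤ _ := h3
      _ ≤ 2 ^ q * (2 ^ (n + 1) * ∫⁻ w in Dball z γ, h w ∂measTau n) := by gcongr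
      _ = _ := by ring
  rw [areaF, ← ENNReal.mul_rpow_of_nonneg _ _ (by positivity), one_div]
  rw [ENNReal.le_rpow_inv_iff hq0]
  exact h4

lemma aux_areaF_meas {n : ℕ} {γ q : ℝ} (hγ : 0 < γ) (f : En n → ℂ) :
    ∃ A : En n → ℝ≥0∞, Measurable A ∧ ∀ z ∈ uball n, A z = areaF γ q (radArea f) z := by
  have hhm : Measurable (fun w => ENNReal.ofReal (radArea f w) ^ q) := by
    have h1 := aux_radD_meas f
    have : Measurable (radArea f) := by unfold radArea; fun_prop
    exact this.ennreal_ofReal.pow_const q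
  obtain ⟨A, hA, H⟩ := aux_area_meas hγ hhm
  refine ⟨fun z => A z ^ (1 / q), hA.pow_const _, ?_⟩
  intro z hz
  show A z ^ (1 / q) = _
  rw [areaF, H z hz]

lemma aux_low_small {n : ℕ} {γ q α p : ℝ} (hγ : 0 < γ) (hq : 1 < q) (hα : -1 < α) (hp : 0 < p) :
    ∃ C : ℝ≥0∞, C < ⊤ ∧ ∀ f : En n → ℂ, DifferentiableOn ℂ f (uball n) → ∀ u : En n, ‖u‖ ≤ 1 / 2 →
      ENNReal.ofReal ‖radD f u‖ ≤ C * (∫⁻ z, (areaF γ q (radArea f) z) ^ p ∂measA n α) ^ (1 / p) := by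
  obtain ⟨C1, hC1, H1⟩ := aux_low_point (n := n) hγ hq
  obtain ⟨C2, hC2, H2⟩ := aux_ball_A (n := n) hα
  have hR := aux_Rg hγ
  set δ := Rg γ / 48 with hδ
  have hδ0 : 0 < δ := div_pos hR.1 (by norm_num)
  have hδ1 : δ < 1 / 48 := by rw [hδ]; linarith
  set v := vol n (Metric.ball (0 : En n) (δ / 2)) with hv
  have hv0 : v ≠ 0 := (aux_vol_pos (by positivity)).ne'
  have hvt : v ≠ ⊤ := measure_ball_lt_top.ne
  have hvi : v⁻¹ < ⊤ := ENNReal.inv_lt_top.2 (pos_iff_ne_zero.2 hv0)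
  have hCp : (2 * C1) ^ p < ⊤ := ENNReal.rpow_lt_top_of_nonneg hp.le (by finiteness)
  refine ⟨(v⁻¹ * ((2 * C1) ^ p * C2)) ^ (1 / p), ENNReal.rpow_lt_top_of_nonneg (by positivity) (by finiteness), ?_⟩
  intro f hf u hu
  obtain ⟨A, hA, HA⟩ := aux_areaF_meas (n := n) (q := q) hγ f
  have huB : u ∈ uball n := aux_ub.2 (by linarith)
  rw [aux_A_congr (k := fun z => A z ^ p) (fun z hz => by rw [HA z hz]), ← ENNReal.mul_rpow_of_nonneg _ _ (by positivity), one_div,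
    ENNReal.le_rpow_inv_iff hp, mul_assoc, ← ENNReal.mul_le_iff_le_inv hv0 hvt]
  have hsub : ∀ z ∈ Metric.ball u (δ / 2), z ∈ Metric.ball (0 : En n) (3 / 4) := by
    intro z hz
    rw [mem_ball_iff_norm] at hz
    rw [mem_ball_zero_iff]
    have := norm_add_le u (z - u)
    rw [add_sub_cancel] at this
    linarith
  have hvv : v = vol n (Metric.ball u (δ / 2)) := by
    rw [hv]; exact (Measure.addHaar_ball_center (vol n) u _).symm
  have hpt : ∀ z ∈ Metric.ball u (δ / 2), ENNReal.ofReal ‖radD f u‖ ^ p ≤ (2 * C1) ^ p * A z ^ p := by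
    intro z hz
    have hz1 := hsub z hz
    rw [mem_ball_iff_norm] at hz
    have hzB : z ∈ uball n := Metric.ball_subset_ball (by norm_num) hz1
    have h34 : 3 / 4 ≤ 1 - ‖u‖ ^ 2 := by nlinarith [norm_nonneg u]
    have h1 := H1 f hf u huB z hzB (by nlinarith)
    rw [← HA z hzB] at h1
    rw [← ENNReal.mul_rpow_of_nonneg _ _ hp.le]
    gcongr
    calc ENNReal.ofReal ‖radD f u‖ ≤ ENNReal.ofReal (2 * radArea f u) := by
          apply ENNReal.ofReal_le_ofReal
          rw [radArea]; nlinarith [norm_nonneg (radD f u)]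
      _ = 2 * ENNReal.ofReal (radArea f u) := by rw [ENNReal.ofReal_mul (by norm_num)]; simp
      _ ≤ 2 * (C1 * A z) := by gcongr
      _ = _ := by ring
  calc v * ENNReal.ofReal ‖radD f u‖ ^ p = ∫⁻ z in Metric.ball u (δ / 2), ENNReal.ofReal ‖radD f u‖ ^ p ∂vol n := by
        rw [setLIntegral_const, hvv, mul_comm]
    _ ≤ ∫⁻ z in Metric.ball u (δ / 2), (2 * C1) ^ p * A z ^ p ∂vol n := setLIntegral_mono' measurableSet_ball hpt
    _ ≤ ∫⁻ z in Metric.ball 0 (3 / 4), (2 * C1) ^ p * A z ^ p ∂vol n := lintegral_mono_set hsub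
    _ = (2 * C1) ^ p * ∫⁻ z in Metric.ball 0 (3 / 4), A z ^ p ∂vol n := lintegral_const_mul _ (hA.pow_const p)
    _ ≤ (2 * C1) ^ p * (C2 * ∫⁻ z, A z ^ p ∂measA n α) := by gcongr; exact H2 _ (hA.pow_const p)
    _ = _ := by ring


lemma aux_add_rpow (a b : ℝ≥0∞) {p : ℝ} (hp : 0 ≤ p) : (a + b) ^ p ≤ 2 ^ p * (a ^ p + b ^ p) := by
  rcases le_total a b with h | h
  · calc (a + b) ^ p ≤ (2 * b) ^ p := by gcongr; rw [two_mul]; gcongr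
      _ = 2 ^ p * b ^ p := ENNReal.mul_rpow_of_nonneg _ _ hp
      _ ≤ _ := by gcongr; exact le_add_self
  · calc (a + b) ^ p ≤ (2 * a) ^ p := by gcongr; rw [two_mul]; gcongr
      _ = 2 ^ p * a ^ p := ENNReal.mul_rpow_of_nonneg _ _ hp
      _ ≤ _ := by gcongr; exact le_self_add

lemma aux_line_deriv {n : ℕ} {f : En n → ℂ} (hf : DifferentiableOn ℂ f (uball n)) {z : En n} {l : ℂ}
    (hl : l • z ∈ uball n) : HasDerivAt (fun l : ℂ => f (l • z)) (fderiv ℂ f (l • z) z) l := by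
  have h2 : HasFDerivAt f (fderiv ℂ f (l • z)) (l • z) := 
    (hf.differentiableAt (Metric.isOpen_ball.mem_nhds hl)).hasFDerivAt
  have h3 : HasDerivAt (fun l : ℂ => l • z) z l := by
    simpa using ((hasDerivAt_id l).smul_const z)
  exact h2.comp_hasDerivAt l h3

lemma aux_radD_smul {n : ℕ} (f : En n → ℂ) (z : En n) (l : ℂ) :
    radD f (l • z) = l * fderiv ℂ f (l • z) z := by
  rw [radD, map_smul, smul_eq_mul]

lemma aux_max {n : ℕ} {f : En n → ℂ} (hf : DifferentiableOn ℂ f (uball n)) {z : En n} (hz : z ∈ uball n) {M : ℝ}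
    (hM : ∀ l : ℂ, ‖l‖ = 1 → ‖radD f (l • z)‖ ≤ M) : ‖f z - f 0‖ ≤ M := by
  have hz1 := aux_ub.1 hz
  have hin : ∀ l : ℂ, ‖l‖ ≤ 1 → l • z ∈ uball n := by
    intro l hl
    rw [aux_ub, norm_smul]
    nlinarith [norm_nonneg z]
  have hd : ∀ l : ℂ, ‖l‖ ≤ 1 → HasDerivAt (fun l : ℂ => f (l • z)) (fderiv ℂ f (l • z) z) l :=
    fun l hl => aux_line_deriv hf (hin l hl)
  have hb : ∀ l ∈ Metric.closedBall (0 : ℂ) 1, ‖fderiv ℂ f (l • z) z‖ ≤ M := by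
    intro l hl
    refine Complex.norm_le_of_forall_mem_frontier_norm_le (U := Metric.ball (0 : ℂ) 1) (f := fun l : ℂ => fderiv ℂ f (l • z) z)
      Metric.isBounded_ball ?_ ?_ (by rwa [closure_ball _ one_ne_zero])
    · refine DifferentiableOn.diffContOnCl ?_
      rw [closure_ball _ one_ne_zero]
      intro m hm
      have := aux_fderiv_line' (z := 0) (x := z) (l := m) Metric.isOpen_ball hf (by rw [zero_add]; exact hin m (by simpa using hm)) z
      simp only [zero_add] at this
      exact this.differentiableWithinAt
    · intro m hm
      rw [frontier_ball _ one_ne_zero, mem_sphere_zero_iff_norm] at hm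
      have := hM m hm
      rw [aux_radD_smul, norm_mul, hm, one_mul] at this
      exact this
  have := Convex.norm_image_sub_le_of_norm_hasDerivWithin_le (f := fun l : ℂ => f (l • z)) (f' := fun l : ℂ => fderiv ℂ f (l • z) z)
    (s := Metric.closedBall (0 : ℂ) 1) (C := M) (x := 0) (y := 1)
    (fun l hl => (hd l (by simpa using hl)).hasDerivWithinAt) hb (convex_closedBall _ _) (by simp) (by simp)
  simpa using this

lemma aux_small {n : ℕ} {γ q α p : ℝ} (hγ : 0 < γ) (hq : 1 < q) (hα : -1 < α) (hp : 0 < p) :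
    ∃ C : ℝ≥0∞, C < ⊤ ∧ ∀ f : En n → ℂ, DifferentiableOn ℂ f (uball n) → ∀ z : En n, ‖z‖ ≤ 1 / 2 →
      ENNReal.ofReal ‖f z‖ ≤ ENNReal.ofReal ‖f 0‖ + C * (∫⁻ z, (areaF γ q (radArea f) z) ^ p ∂measA n α) ^ (1 / p) := by
  obtain ⟨C, hC, H⟩ := aux_low_small (n := n) hγ hq hα hp
  refine ⟨C, hC, ?_⟩
  intro f hf z hz
  set N := C * (∫⁻ z, (areaF γ q (radArea f) z) ^ p ∂measA n α) ^ (1 / p) with hN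
  by_cases hNt : N = ⊤
  · rw [hNt]; simp
  have h1 := aux_max hf (z := z) (aux_ub.2 (by linarith)) (M := N.toReal) (by
    intro l hl
    have := H f hf (l • z) (by rw [norm_smul, hl, one_mul]; exact hz)
    exact (ENNReal.ofReal_le_iff_le_toReal hNt).1 this)
  have h2 : ‖f z‖ ≤ ‖f 0‖ + N.toReal := by
    have := norm_add_le (f z - f 0) (f 0)
    rw [sub_add_cancel] at this
    linarith
  calc ENNReal.ofReal ‖f z‖ ≤ ENNReal.ofReal (‖f 0‖ + N.toReal) := ENNReal.ofReal_le_ofReal h2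
    _ = _ := by rw [ENNReal.ofReal_add (norm_nonneg _) ENNReal.toReal_nonneg, ENNReal.ofReal_toReal hNt]

lemma aux_growth {n : ℕ} {f : En n → ℂ} (hf : DifferentiableOn ℂ f (uball n)) {z : En n} (hz : z ∈ uball n)
    (hz2 : 1 / 2 < ‖z‖) {ε : ℝ} (hε : 0 < ε) : ∃ t ∈ Set.Icc (1 / (2 * ‖z‖)) 1,
      ‖f z‖ ≤ ‖f (((1 / (2 * ‖z‖) : ℝ) : ℂ) • z)‖ +
        4 / ε * ((1 - t * ‖z‖) ^ (1 + ε) * ‖radD f ((t : ℂ) • z)‖) * (1 - ‖z‖) ^ (-ε) := by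
  have hz1 := aux_ub.1 hz
  set r := ‖z‖ with hr
  have hr0 : 0 < r := by linarith
  set a : ℝ := 1 / (2 * r) with ha
  have ha1 : a ≤ 1 := by rw [ha, div_le_one (by linarith)]; linarith
  have ha2 : 1 / 2 ≤ a := by rw [ha]; gcongr; linarith
  have hin : ∀ t ∈ Set.Icc a 1, (t : ℂ) • z ∈ uball n := by
    intro t ht
    rw [aux_ub, norm_smul, Complex.norm_real, Real.norm_of_nonneg (by linarith [ht.1]), ← hr]
    nlinarith [ht.1, ht.2]
  have hpos : ∀ t ∈ Set.Icc a 1, 0 < 1 - t * r := by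
    intro t ht; nlinarith [ht.1, ht.2]
  have hcont : ContinuousOn (fun t : ℝ => (1 - t * r) ^ (1 + ε) * ‖radD f ((t : ℂ) • z)‖) (Set.Icc a 1) := by
    apply ContinuousOn.mul
    · intro t ht
      refine ContinuousAt.continuousWithinAt ?_
      exact ContinuousAt.rpow_const (by fun_prop) (Or.inl (hpos t ht).ne')
    · apply ContinuousOn.norm
      intro t ht
      have h1 := aux_radD_line hf (z := 0) (x := z) (l := (t : ℂ)) (by rw [zero_add]; exact hin t ht)
      simp only [zero_add] at h1
      exact (ContinuousAt.comp (f := fun t : ℝ => (t : ℂ)) h1.continuousAt Complex.continuous_ofReal.continuousAt).continuousWithinAt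
  obtain ⟨t0, ht0, hmax⟩ := isCompact_Icc.exists_isMaxOn (Set.nonempty_Icc.2 ha1) hcont
  refine ⟨t0, ht0, ?_⟩
  set S := (1 - t0 * r) ^ (1 + ε) * ‖radD f ((t0 : ℂ) • z)‖ with hS
  have hS0 : 0 ≤ S := mul_nonneg (Real.rpow_nonneg (hpos t0 ht0).le _) (norm_nonneg _)
  have hbd : ∀ t ∈ Set.Icc a 1, ‖radD f ((t : ℂ) • z)‖ ≤ S * (1 - t * r) ^ (-ε - 1) := by
    intro t ht
    have h1 : (1 - t * r) ^ (1 + ε) * ‖radD f ((t : ℂ) • z)‖ ≤ S := hmax ht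
    have h2 := hpos t ht
    have h3 : (1 - t * r) ^ (-ε - 1) = ((1 - t * r) ^ (1 + ε))⁻¹ := by
      rw [← Real.rpow_neg h2.le]; congr 1; ring
    rw [h3, ← div_eq_mul_inv, le_div_iff₀' (by positivity)]
    exact h1
  have hg : ∀ t ∈ Set.Icc a 1, HasDerivAt (fun t : ℝ => f ((t : ℂ) • z)) (fderiv ℂ f ((t : ℂ) • z) z) t :=
    fun t ht => (aux_line_deriv hf (hin t ht)).comp_ofReal
  have hB : ∀ t ∈ Set.Icc a 1, HasDerivAt (fun t : ℝ => ‖f ((a : ℂ) • z)‖ + 4 / ε * S * (1 - t * r) ^ (-ε))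
      (4 * S * r * (1 - t * r) ^ (-ε - 1)) t := by
    intro t ht
    have h1 : HasDerivAt (fun t : ℝ => 1 - t * r) (-r) t := by
      simpa using ((hasDerivAt_id t).mul_const r).const_sub 1
    have h2 := ((h1.rpow_const (p := -ε) (Or.inl (hpos t ht).ne')).const_mul (4 / ε * S)).const_add ‖f ((a : ℂ) • z)‖
    refine h2.congr_deriv ?_
    field_simp
  have key := image_norm_le_of_norm_deriv_right_le_deriv_boundary' (f := fun t : ℝ => f ((t : ℂ) • z))
    (f' := fun t : ℝ => fderiv ℂ f ((t : ℂ) • z) z) (a := a) (b := 1)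
    (B := fun t : ℝ => ‖f ((a : ℂ) • z)‖ + 4 / ε * S * (1 - t * r) ^ (-ε))
    (B' := fun t : ℝ => 4 * S * r * (1 - t * r) ^ (-ε - 1))
    (fun t ht => (hg t ht).continuousAt.continuousWithinAt)
    (fun t ht => (hg t ⟨ht.1, ht.2.le⟩).hasDerivWithinAt)
    (by
      have := (hpos a ⟨le_rfl, ha1⟩)
      have : 0 ≤ 4 / ε * S * (1 - a * r) ^ (-ε) := by positivity
      linarith)
    (fun t ht => (hB t ht).continuousAt.continuousWithinAt)
    (fun t ht => (hB t ⟨ht.1, ht.2.le⟩).hasDerivWithinAt)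
    (by
      intro t ht
      have ht' : t ∈ Set.Icc a 1 := ⟨ht.1, ht.2.le⟩
      have h1 := hbd t ht'
      have ht1 : 1 / 2 ≤ t := ha2.trans ht.1
      rw [aux_radD_smul, norm_mul, Complex.norm_real, Real.norm_of_nonneg (by linarith)] at h1
      have h2 : 0 ≤ S * (1 - t * r) ^ (-ε - 1) := mul_nonneg hS0 (Real.rpow_nonneg (hpos t ht').le _)
      have h3 := mul_le_mul_of_nonneg_right ht1 (norm_nonneg (fderiv ℂ f ((t : ℂ) • z) z))
      have h4 := mul_le_mul_of_nonneg_right hz2.le h2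
      calc _ ≤ 2 * (S * (1 - t * r) ^ (-ε - 1)) := by linarith
        _ ≤ _ := by linarith)
  have := key (x := 1) ⟨ha1, le_rfl⟩
  simpa using this


lemma aux_L4 {n : ℕ} {γ q p η : ℝ} (hγ : 0 < γ) (hq : 1 < q) (hp : 0 < p) (hη : 0 < η) (hη1 : η ≤ 1) :
    ∃ C : ℝ≥0∞, C < ⊤ ∧ ∀ f : En n → ℂ, DifferentiableOn ℂ f (uball n) → ∀ A : En n → ℝ≥0∞,
      (∀ z ∈ uball n, A z = areaF γ q (radArea f) z) → ∀ z ∈ uball n, 1 / 2 < ‖z‖ →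
      ∀ t0 ∈ Set.Icc (1 / (2 * ‖z‖)) 1,
      ENNReal.ofReal ((1 - t0 * ‖z‖) ^ (1 + η / p) * ‖radD f ((t0 : ℂ) • z)‖) ^ p ≤
        C * ∫⁻ t in Set.Ioo (1 / 4 : ℝ) 1, ENNReal.ofReal ((1 - t * ‖z‖) ^ (η - 1)) * A ((t : ℂ) • z) ^ p := by
  obtain ⟨C1, hC1, H1⟩ := aux_low_point (n := n) hγ hq
  have hR := aux_Rg hγ
  set δ := Rg γ / 48 with hδ
  have hδ0 : 0 < δ := div_pos hR.1 (by norm_num)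
  have hδ1 : δ < 1 / 48 := by rw [hδ]; linarith
  refine ⟨ENNReal.ofReal (2 / δ) * C1 ^ p, ENNReal.mul_lt_top ENNReal.ofReal_lt_top (ENNReal.rpow_lt_top_of_nonneg hp.le hC1.ne), ?_⟩
  intro f hf A hA z hz hz2 t0 ht0
  have hz1 := aux_ub.1 hz
  set r := ‖z‖ with hr
  have ha2 : 1 / 2 < t0 := by
    refine lt_of_lt_of_le ?_ ht0.1
    rw [lt_div_iff₀ (by linarith)]; linarith
  have hnorm : ∀ t : ℝ, 0 ≤ t → ‖(t : ℂ) • z‖ = t * r := by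
    intro t ht
    rw [norm_smul, Complex.norm_real, Real.norm_of_nonneg ht]
  set ρ := t0 * r with hρ
  have hρ1 : ρ < 1 := by nlinarith [ht0.2]
  have hρ0 : 0 < ρ := by positivity
  set m := 1 - ρ with hm
  have hm0 : 0 < m := by linarith
  have hm1 : m < 1 := by linarith
  set u := (t0 : ℂ) • z with hu
  have hun : ‖u‖ = ρ := hnorm t0 (by linarith)
  have huB : u ∈ uball n := aux_ub.2 (by rw [hun]; exact hρ1)
  set c := δ * m with hc
  have hc0 : 0 < c := by positivity
  have hc1 : c < 1 / 48 := by nlinarith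
  set S := m ^ (1 + η / p) * ‖radD f u‖ with hS
  set G : ℝ → ℝ≥0∞ := fun t => ENNReal.ofReal ((1 - t * r) ^ (η - 1)) * A ((t : ℂ) • z) ^ p with hG
  have hSr : S ≤ m ^ (η / p) * radArea f u := by
    rw [hS, Real.rpow_add hm0, Real.rpow_one, radArea, hun]
    have : m ≤ 1 - ρ ^ 2 := by nlinarith
    calc m * m ^ (η / p) * ‖radD f u‖ = m ^ (η / p) * (m * ‖radD f u‖) := by ring
      _ ≤ _ := by gcongr
  have hSp : ENNReal.ofReal S ^ p ≤ ENNReal.ofReal (m ^ η) * ENNReal.ofReal (radArea f u) ^ p := by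
    calc ENNReal.ofReal S ^ p ≤ (ENNReal.ofReal (m ^ (η / p) * radArea f u)) ^ p := by gcongr
      _ = _ := by
        rw [ENNReal.ofReal_mul (by positivity), ENNReal.mul_rpow_of_nonneg _ _ hp.le, ENNReal.ofReal_rpow_of_pos (by positivity),
          ← Real.rpow_mul hm0.le, div_mul_cancel₀ _ hp.ne']
  have hpt : ∀ t ∈ Set.Ioo (t0 - c) t0, ENNReal.ofReal S ^ p ≤ ENNReal.ofReal (2 * m) * C1 ^ p * G t := by
    intro t ht
    have ht4 : 1 / 4 < t := by linarith [ht.1]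
    have ht1 : t < 1 := by linarith [ht.2, ht0.2]
    have htB : (t : ℂ) • z ∈ uball n := by
      rw [aux_ub, hnorm t (by linarith)]; nlinarith
    have hd : ‖(t : ℂ) • z - u‖ ≤ δ * (1 - ‖u‖ ^ 2) := by
      rw [hu, ← sub_smul, norm_smul, ← Complex.ofReal_sub, Complex.norm_real, Real.norm_eq_abs, ← hu, hun, ← hr]
      have h1 : |t - t0| ≤ c := by rw [abs_le]; constructor <;> linarith [ht.1, ht.2]
      have : m ≤ 1 - ρ ^ 2 := by nlinarith
      calc |t - t0| * r ≤ c * 1 := by gcongr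
        _ ≤ _ := by rw [mul_one, hc]; gcongr
    have h1 := H1 f hf u huB _ htB hd
    rw [← hA _ htB] at h1
    have hlo : m ≤ 1 - t * r := by nlinarith [ht.2]
    have hhi : 1 - t * r ≤ 2 * m := by
      have : (t0 - t) * r ≤ c * 1 := by
        gcongr
        · linarith [ht.1]
      nlinarith
    have hw : m ^ η ≤ 2 * m * (1 - t * r) ^ (η - 1) := by
      have e1 : (2 * m) ^ (η - 1) ≤ (1 - t * r) ^ (η - 1) :=
        Real.rpow_le_rpow_of_nonpos (by linarith) hhi (by linarith)
      have e2 : m ^ η ≤ 2 * m * (2 * m) ^ (η - 1) := by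
        rw [Real.rpow_sub_one (by positivity), mul_div_cancel₀ _ (by positivity)]
        exact Real.rpow_le_rpow hm0.le (by linarith) hη.le
      exact e2.trans (by gcongr)
    calc ENNReal.ofReal S ^ p ≤ ENNReal.ofReal (m ^ η) * ENNReal.ofReal (radArea f u) ^ p := hSp
      _ ≤ ENNReal.ofReal (2 * m * (1 - t * r) ^ (η - 1)) * (C1 * A ((t : ℂ) • z)) ^ p := by gcongr
      _ = _ := by
        rw [ENNReal.ofReal_mul (by positivity), ENNReal.mul_rpow_of_nonneg _ _ hp.le, hG]
        ring
  have hsub : Set.Ioo (t0 - c) t0 ⊆ Set.Ioo (1 / 4 : ℝ) 1 := by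
    intro t ht
    exact ⟨by linarith [ht.1], by linarith [ht.2, ht0.2]⟩
  have hK : ENNReal.ofReal (2 * m) * C1 ^ p ≠ ⊤ := ENNReal.mul_ne_top ENNReal.ofReal_ne_top (ENNReal.rpow_ne_top_of_nonneg hp.le hC1.ne)
  have hint : ENNReal.ofReal S ^ p * ENNReal.ofReal c ≤ ENNReal.ofReal (2 * m) * C1 ^ p * ∫⁻ t in Set.Ioo (1 / 4 : ℝ) 1, G t := by
    calc ENNReal.ofReal S ^ p * ENNReal.ofReal c = ∫⁻ t in Set.Ioo (t0 - c) t0, ENNReal.ofReal S ^ p := by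
          rw [setLIntegral_const, Real.volume_Ioo]; congr 2; ring
      _ ≤ ∫⁻ t in Set.Ioo (t0 - c) t0, ENNReal.ofReal (2 * m) * C1 ^ p * G t := setLIntegral_mono' measurableSet_Ioo hpt
      _ = ENNReal.ofReal (2 * m) * C1 ^ p * ∫⁻ t in Set.Ioo (t0 - c) t0, G t := lintegral_const_mul' _ _ hK
      _ ≤ _ := by gcongr
  rw [mul_comm, ENNReal.mul_le_iff_le_inv (by simpa using hc0) ENNReal.ofReal_ne_top] at hint
  refine hint.trans (le_of_eq ?_)
  rw [← mul_assoc, ← mul_assoc, ← ENNReal.ofReal_inv_of_pos hc0, ← ENNReal.ofReal_mul (by positivity)]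
  congr 3
  rw [hc]; field_simp


lemma aux_L5 {n : ℕ} {γ q α p η : ℝ} (hγ : 0 < γ) (hq : 1 < q) (hα : -1 < α) (hp : 0 < p) (hη : 0 < η) (hη1 : η ≤ 1) :
    ∃ C : ℝ≥0∞, C < ⊤ ∧ ∀ f : En n → ℂ, DifferentiableOn ℂ f (uball n) → ∀ A : En n → ℝ≥0∞,
      (∀ z ∈ uball n, A z = areaF γ q (radArea f) z) → ∀ z ∈ uball n,
      ENNReal.ofReal ‖f z‖ ^ p ≤
        C * (ENNReal.ofReal ‖f 0‖ ^ p + (∫⁻ z, (areaF γ q (radArea f) z) ^ p ∂measA n α) +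
          ENNReal.ofReal ((1 - ‖z‖) ^ (-η)) *
          ∫⁻ t in Set.Ioo (1 / 4 : ℝ) 1, ENNReal.ofReal ((1 - t * ‖z‖) ^ (η - 1)) * A ((t : ℂ) • z) ^ p) := by
  obtain ⟨Cs, hCs, Hs⟩ := aux_small (n := n) hγ hq hα hp
  obtain ⟨C4, hC4, H4⟩ := aux_L4 (n := n) hγ hq hp hη hη1
  set ε := η / p with hε
  have hε0 : 0 < ε := by positivity
  set K : ℝ≥0∞ := 2 ^ p * (1 + Cs ^ p) with hK
  set D : ℝ≥0∞ := ENNReal.ofReal (4 / ε) ^ p * C4 with hD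
  have h2p : (2 : ℝ≥0∞) ^ p < ⊤ := ENNReal.rpow_lt_top_of_nonneg hp.le (by simp)
  have hKt : K < ⊤ := ENNReal.mul_lt_top h2p (ENNReal.add_lt_top.2 ⟨by simp, ENNReal.rpow_lt_top_of_nonneg hp.le hCs.ne⟩)
  have hDt : D < ⊤ := ENNReal.mul_lt_top (ENNReal.rpow_lt_top_of_nonneg hp.le ENNReal.ofReal_ne_top) hC4
  refine ⟨K + 2 ^ p * (K + D), ENNReal.add_lt_top.2 ⟨hKt, ENNReal.mul_lt_top h2p (ENNReal.add_lt_top.2 ⟨hKt, hDt⟩)⟩, ?_⟩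
  intro f hf A hA z hz
  have hz1 := aux_ub.1 hz
  set N := ∫⁻ z, (areaF γ q (radArea f) z) ^ p ∂measA n α with hN
  set a := ENNReal.ofReal ‖f 0‖ ^ p with ha
  have hsm : ∀ x : En n, ‖x‖ ≤ 1 / 2 → ENNReal.ofReal ‖f x‖ ^ p ≤ K * (a + N) := by
    intro x hx
    calc ENNReal.ofReal ‖f x‖ ^ p ≤ (ENNReal.ofReal ‖f 0‖ + Cs * N ^ (1 / p)) ^ p := by
          gcongr; exact Hs f hf x hx
      _ ≤ 2 ^ p * (a + (Cs * N ^ (1 / p)) ^ p) := aux_add_rpow _ _ hp.le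
      _ = 2 ^ p * (1 * a + Cs ^ p * N) := by
          rw [ENNReal.mul_rpow_of_nonneg _ _ hp.le, ← ENNReal.rpow_mul, one_div_mul_cancel hp.ne', ENNReal.rpow_one, one_mul]
      _ ≤ 2 ^ p * ((1 + Cs ^ p) * a + (1 + Cs ^ p) * N) := by
          gcongr
          · exact le_self_add
          · exact le_add_self
      _ = _ := by rw [hK]; ring
  set J := ENNReal.ofReal ((1 - ‖z‖) ^ (-η)) *
          ∫⁻ t in Set.Ioo (1 / 4 : ℝ) 1, ENNReal.ofReal ((1 - t * ‖z‖) ^ (η - 1)) * A ((t : ℂ) • z) ^ p with hJ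
  rcases le_or_gt ‖z‖ (1 / 2) with h | h
  · exact (hsm z h).trans (mul_le_mul' le_self_add le_self_add)
  · obtain ⟨t0, ht0, hg⟩ := aux_growth hf hz h hε0
    have h4 := H4 f hf A hA z hz h t0 ht0
    set S := (1 - t0 * ‖z‖) ^ (1 + ε) * ‖radD f ((t0 : ℂ) • z)‖ with hS
    have hS0 : 0 ≤ S := by
      have : 0 ≤ 1 - t0 * ‖z‖ := by nlinarith [ht0.2, norm_nonneg z]
      positivity
    have hpos : 0 < 1 - ‖z‖ := by linarith
    set x := (((1 / (2 * ‖z‖) : ℝ) : ℂ) • z) with hx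
    have hxn : ‖x‖ ≤ 1 / 2 := by
      rw [hx, norm_smul, Complex.norm_real, Real.norm_of_nonneg (by positivity)]
      apply le_of_eq; field_simp
    have hm : (ENNReal.ofReal (4 / ε * S * (1 - ‖z‖) ^ (-ε))) ^ p ≤ D * J := by
      rw [ENNReal.ofReal_mul (by positivity), ENNReal.ofReal_mul (by positivity), ENNReal.mul_rpow_of_nonneg _ _ hp.le,
        ENNReal.mul_rpow_of_nonneg _ _ hp.le, ENNReal.ofReal_rpow_of_pos (x := (1 - ‖z‖) ^ (-ε)) (by positivity), ← Real.rpow_mul hpos.le]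
      have : -ε * p = -η := by rw [hε]; field_simp
      rw [this, hD, hJ]
      calc _ ≤ ENNReal.ofReal (4 / ε) ^ p * (C4 * ∫⁻ t in Set.Ioo (1 / 4 : ℝ) 1, ENNReal.ofReal ((1 - t * ‖z‖) ^ (η - 1)) * A ((t : ℂ) • z) ^ p) * ENNReal.ofReal ((1 - ‖z‖) ^ (-η)) := by gcongr
        _ = _ := by ring
    calc ENNReal.ofReal ‖f z‖ ^ p ≤ (ENNReal.ofReal ‖f x‖ + ENNReal.ofReal (4 / ε * S * (1 - ‖z‖) ^ (-ε))) ^ p := by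
          gcongr
          rw [← ENNReal.ofReal_add (norm_nonneg _) (by positivity)]
          exact ENNReal.ofReal_le_ofReal hg
      _ ≤ 2 ^ p * (ENNReal.ofReal ‖f x‖ ^ p + (ENNReal.ofReal (4 / ε * S * (1 - ‖z‖) ^ (-ε))) ^ p) := aux_add_rpow _ _ hp.le
      _ ≤ 2 ^ p * (K * (a + N) + D * J) := by
          gcongr; exact hsm x hxn
      _ ≤ 2 ^ p * ((K + D) * (a + N) + (K + D) * J) := by
          gcongr
          · exact le_self_add
          · exact le_add_self
      _ = 2 ^ p * (K + D) * (a + N + J) := by ring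
      _ ≤ _ := by gcongr; exact le_add_self


lemma aux_inner_int {β s : ℝ} (hβ : -1 < β) (hs : s ≤ 1) :
    ∫⁻ t in Set.Ioo s 1, ENNReal.ofReal ((t - s) ^ β) = ENNReal.ofReal ((1 - s) ^ (β + 1) / (β + 1)) := by
  have h1 : IntervalIntegrable (fun t : ℝ => (t - s) ^ β) volume s 1 := by
    have := (intervalIntegral.intervalIntegrable_rpow' (a := 0) (b := 1 - s) hβ).comp_sub_right s
    simpa using this
  have h2 : ∫ t in s..1, (t - s) ^ β = (1 - s) ^ (β + 1) / (β + 1) := by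
    rw [intervalIntegral.integral_comp_sub_right (fun x : ℝ => x ^ β) s, integral_rpow (Or.inl hβ), sub_self,
      Real.zero_rpow (by linarith), sub_zero]
  rw [← h2, intervalIntegral.integral_of_le hs, ofReal_integral_eq_lintegral_ofReal h1.1, setLIntegral_congr Ioo_ae_eq_Ioc]
  refine (ae_restrict_iff' measurableSet_Ioc).2 (ae_of_all _ fun t ht => ?_)
  exact Real.rpow_nonneg (by linarith [ht.1]) _

def Kh {n : ℕ} (β : ℝ) (w : En n) (t : ℝ) : ℝ≥0∞ := if ‖w‖ < t then ENNReal.ofReal ((1 - ‖w‖ / t) ^ β) else 0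

lemma aux_Kh_meas {n : ℕ} (β : ℝ) : Measurable (fun x : En n × ℝ => Kh β x.1 x.2) := by
  unfold Kh
  refine Measurable.ite (measurableSet_lt (by fun_prop) (by fun_prop)) ?_ measurable_const
  fun_prop

lemma aux_Kh_meas1 {n : ℕ} (β : ℝ) (w : En n) : Measurable (fun t : ℝ => Kh β w t) := by
  unfold Kh
  refine Measurable.ite (measurableSet_lt (by fun_prop) (by fun_prop)) ?_ measurable_const
  fun_prop

lemma aux_Kh_meas2 {n : ℕ} (β : ℝ) (t : ℝ) : Measurable (fun w : En n => Kh β w t) := by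
  unfold Kh
  refine Measurable.ite (measurableSet_lt (by fun_prop) (by fun_prop)) ?_ measurable_const
  fun_prop

lemma aux_Kh_int {n : ℕ} {β : ℝ} (hβ : -1 < β) (w : En n) :
    ∫⁻ t in Set.Ioo (1 / 4 : ℝ) 1, Kh β w t ≤
      (uball n).indicator (fun w => ENNReal.ofReal (4 ^ |β| / (β + 1)) * ENNReal.ofReal ((1 - ‖w‖) ^ (β + 1))) w := by
  by_cases hw : w ∈ uball n
  · rw [Set.indicator_of_mem hw]
    have hw1 := aux_ub.1 hw
    calc ∫⁻ t in Set.Ioo (1 / 4 : ℝ) 1, Kh β w t ≤ ∫⁻ t in Set.Ioo (1 / 4 : ℝ) 1, (Set.Ioo ‖w‖ 1).indicator (fun t => ENNReal.ofReal (4 ^ |β|) * ENNReal.ofReal ((t - ‖w‖) ^ β)) t := by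
          refine setLIntegral_mono' measurableSet_Ioo ?_
          intro t ht
          unfold Kh
          split_ifs with h
          · rw [Set.indicator_of_mem (show t ∈ Set.Ioo ‖w‖ 1 from ⟨h, ht.2⟩), ← ENNReal.ofReal_mul (by positivity)]
            apply ENNReal.ofReal_le_ofReal
            have ht0 : 0 < t := by linarith [ht.1]
            have e : 1 - ‖w‖ / t = t⁻¹ * (t - ‖w‖) := by field_simp
            rw [e, Real.mul_rpow (by positivity) (by linarith)]
            have h0 : 0 ≤ (t - ‖w‖) ^ β := Real.rpow_nonneg (by linarith) _
            gcongr
            have h4 : t⁻¹ ≤ 4 := by rw [inv_le_comm₀ ht0 (by norm_num)]; linarith [ht.1]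
            have h1 : 1 ≤ t⁻¹ := (one_le_inv₀ ht0).2 ht.2.le
            calc t⁻¹ ^ β ≤ t⁻¹ ^ |β| := Real.rpow_le_rpow_of_exponent_le h1 (le_abs_self _)
              _ ≤ _ := Real.rpow_le_rpow (by positivity) h4 (abs_nonneg _)
          · exact zero_le
      _ ≤ ∫⁻ t, (Set.Ioo ‖w‖ 1).indicator (fun t => ENNReal.ofReal (4 ^ |β|) * ENNReal.ofReal ((t - ‖w‖) ^ β)) t := setLIntegral_le_lintegral _ _
      _ = _ := by
        rw [lintegral_indicator measurableSet_Ioo, lintegral_const_mul' _ _ ENNReal.ofReal_ne_top, aux_inner_int hβ hw1.le,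
          ← ENNReal.ofReal_mul (by positivity), ← ENNReal.ofReal_mul (div_nonneg (by positivity) (by linarith))]
        congr 1; ring
  · rw [Set.indicator_of_notMem hw]
    rw [aux_ub, not_lt] at hw
    refine le_of_eq ?_
    rw [← lintegral_zero (μ := volume.restrict (Set.Ioo (1 / 4 : ℝ) 1))]
    refine setLIntegral_congr_fun measurableSet_Ioo fun t ht => ?_
    unfold Kh
    rw [if_neg (by linarith [ht.2])]

lemma aux_dil {n : ℕ} {t : ℝ} (ht : 1 / 4 < t) {g : En n → ℝ≥0∞} (hg : Measurable g) :
    ∫⁻ z, g ((t : ℂ) • z) ∂vol n ≤ ENNReal.ofReal ((4 : ℝ) ^ (2 * n)) * ∫⁻ z, g z ∂vol n := by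
  have ht0 : 0 < t := by linarith
  have hdet : LinearMap.det ((t : ℂ) • (LinearMap.id : En n →ₗ[ℂ] En n)) = (t : ℂ) ^ n := by
    rw [LinearMap.det_smul]; simp
  have hne : (t : ℂ) ≠ 0 := Complex.ofReal_ne_zero.2 ht0.ne'
  have h1 := aux_lintegral_lin ((t : ℂ) • (LinearMap.id : En n →ₗ[ℂ] En n))
    (by rw [hdet]; exact pow_ne_zero _ hne) hg
  rw [hdet] at h1
  simp only [LinearMap.smul_apply, LinearMap.id_apply] at h1
  rw [h1]
  have h2 : (‖(t : ℂ) ^ n‖ ^ 2)⁻¹ ≤ (4 : ℝ) ^ (2 * n) := by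
    rw [norm_pow, Complex.norm_real, Real.norm_of_nonneg ht0.le, ← pow_mul, mul_comm n 2, ← inv_pow]
    have : t⁻¹ ≤ 4 := by rw [inv_le_comm₀ ht0 (by norm_num)]; linarith
    exact pow_le_pow_left₀ (by positivity) this _
  exact mul_le_mul_left (ENNReal.ofReal_le_ofReal h2) _

lemma aux_hardy' {n : ℕ} {β : ℝ} (c d : ℝ≥0∞) (hct : c ≠ ⊤) (hdt : d ≠ ⊤)
    (hdil : ∀ t : ℝ, 1 / 4 < t → ∀ g : En n → ℝ≥0∞, Measurable g → ∫⁻ z, g ((t : ℂ) • z) ∂vol n ≤ c * ∫⁻ z, g z ∂vol n)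
    (hki : ∀ w : En n, ∫⁻ t in Set.Ioo (1 / 4 : ℝ) 1, Kh β w t ≤
      (uball n).indicator (fun w => d * ENNReal.ofReal ((1 - ‖w‖) ^ (β + 1))) w) (H : En n → ℝ≥0∞) (hH : Measurable H) :
    ∫⁻ z in uball n, ENNReal.ofReal ((1 - ‖z‖) ^ β) * (∫⁻ t in Set.Ioo (1 / 4 : ℝ) 1, H ((t : ℂ) • z)) ∂vol n ≤
      c * d * ∫⁻ w in uball n, ENNReal.ofReal ((1 - ‖w‖) ^ (β + 1)) * H w ∂vol n := by
  have hKm := aux_Kh_meas (n := n) β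
  have hsm : Measurable (fun x : En n × ℝ => (x.2 : ℂ) • x.1) := by fun_prop
  have hFm : Measurable (fun x : En n × ℝ => Kh β ((x.2 : ℂ) • x.1) x.2 * H ((x.2 : ℂ) • x.1)) :=
    (hKm.comp (hsm.prodMk measurable_snd)).mul (hH.comp hsm)
  have hGm : Measurable (fun x : ℝ × En n => Kh β x.2 x.1 * H x.2) :=
    (hKm.comp measurable_swap).mul (hH.comp measurable_snd)
  have hstep : ∀ t ∈ Set.Ioo (1 / 4 : ℝ) 1, ∫⁻ z, Kh β ((t : ℂ) • z) t * H ((t : ℂ) • z) ∂vol n ≤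
      c * ∫⁻ w, Kh β w t * H w ∂vol n := by
    intro t ht
    have hg : Measurable (fun w : En n => Kh β w t * H w) := 
      (aux_Kh_meas2 β t).mul hH
    exact hdil t ht.1 _ hg
  have s1 : ∫⁻ z in uball n, ENNReal.ofReal ((1 - ‖z‖) ^ β) * (∫⁻ t in Set.Ioo (1 / 4 : ℝ) 1, H ((t : ℂ) • z)) ∂vol n
      ≤ ∫⁻ z in uball n, (∫⁻ t in Set.Ioo (1 / 4 : ℝ) 1, Kh β ((t : ℂ) • z) t * H ((t : ℂ) • z)) ∂vol n := by
    refine setLIntegral_mono' (aux_uball_meas n) ?_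
    intro z hz
    have hz1 := aux_ub.1 hz
    rw [← lintegral_const_mul' _ _ ENNReal.ofReal_ne_top]
    refine setLIntegral_mono' measurableSet_Ioo ?_
    intro t ht
    have ht0 : 0 < t := by linarith [ht.1]
    unfold Kh
    rw [norm_smul, Complex.norm_real, Real.norm_of_nonneg ht0.le, if_pos (by nlinarith), mul_div_cancel_left₀ _ ht0.ne']
  refine s1.trans ((setLIntegral_le_lintegral _ _).trans ?_)
  have s2 : ∫⁻ z, (∫⁻ t in Set.Ioo (1 / 4 : ℝ) 1, Kh β ((t : ℂ) • z) t * H ((t : ℂ) • z)) ∂vol n =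
    ∫⁻ t in Set.Ioo (1 / 4 : ℝ) 1, ∫⁻ z, Kh β ((t : ℂ) • z) t * H ((t : ℂ) • z) ∂vol n :=
        lintegral_lintegral_swap hFm.aemeasurable
  rw [s2]
  have s3 : ∫⁻ t in Set.Ioo (1 / 4 : ℝ) 1, ∫⁻ z, Kh β ((t : ℂ) • z) t * H ((t : ℂ) • z) ∂vol n ≤
      ∫⁻ t in Set.Ioo (1 / 4 : ℝ) 1, c * ∫⁻ w, Kh β w t * H w ∂vol n := setLIntegral_mono' measurableSet_Ioo hstep
  refine s3.trans ?_
  rw [lintegral_const_mul' _ _ hct, mul_assoc]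
  refine mul_le_mul_right ?_ c
  have s4 : ∫⁻ t in Set.Ioo (1 / 4 : ℝ) 1, ∫⁻ w, Kh β w t * H w ∂vol n =
    ∫⁻ w, (∫⁻ t in Set.Ioo (1 / 4 : ℝ) 1, Kh β w t * H w) ∂vol n := lintegral_lintegral_swap hGm.aemeasurable
  rw [s4, ← lintegral_const_mul' _ _ hdt, ← lintegral_indicator (aux_uball_meas n)]
  refine lintegral_mono fun w => ?_
  have hk : Measurable (fun t => Kh β w t) := aux_Kh_meas1 β w
  rw [lintegral_mul_const _ hk]
  refine (mul_le_mul_left (hki w) _).trans (le_of_eq ?_)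
  by_cases hw : w ∈ uball n
  · rw [Set.indicator_of_mem hw, Set.indicator_of_mem hw, mul_assoc]
  · rw [Set.indicator_of_notMem hw, Set.indicator_of_notMem hw, zero_mul]

lemma aux_hardy {n : ℕ} {β : ℝ} (hβ : -1 < β) : ∃ C : ℝ≥0∞, C < ⊤ ∧ ∀ H : En n → ℝ≥0∞, Measurable H →
    ∫⁻ z in uball n, ENNReal.ofReal ((1 - ‖z‖) ^ β) * (∫⁻ t in Set.Ioo (1 / 4 : ℝ) 1, H ((t : ℂ) • z)) ∂vol n ≤
      C * ∫⁻ w in uball n, ENNReal.ofReal ((1 - ‖w‖) ^ (β + 1)) * H w ∂vol n := 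
  ⟨_, ENNReal.mul_lt_top ENNReal.ofReal_lt_top ENNReal.ofReal_lt_top, fun H hH =>
    aux_hardy' _ _ ENNReal.ofReal_ne_top ENNReal.ofReal_ne_top (fun _ ht _ hg => aux_dil ht hg) (aux_Kh_int hβ) H hH⟩


lemma aux_rpow_two {x α : ℝ} (hx : 1 ≤ x) (hx2 : x ≤ 2) : x ^ α ≤ 2 ^ |α| ∧ 1 ≤ 2 ^ |α| * x ^ α := by
  have hx0 : 0 < x := by linarith
  have h1 : x ^ |α| ≤ 2 ^ |α| := Real.rpow_le_rpow hx0.le hx2 (abs_nonneg _)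
  refine ⟨(Real.rpow_le_rpow_of_exponent_le hx (le_abs_self _)).trans h1, ?_⟩
  have h2 : x ^ (-|α|) ≤ x ^ α := Real.rpow_le_rpow_of_exponent_le hx (neg_abs_le α)
  calc (1 : ℝ) = x ^ |α| * x ^ (-|α|) := by rw [← Real.rpow_add hx0]; simp
    _ ≤ _ := by gcongr

lemma aux_dens_cmp {n : ℕ} {α : ℝ} (hα : -1 < α) : ∃ c1 c2 : ℝ≥0∞, c1 < ⊤ ∧ c2 < ⊤ ∧ ∀ z ∈ uball n,
    ENNReal.ofReal (cnorm n α * (1 - ‖z‖ ^ 2) ^ α) ≤ c1 * ENNReal.ofReal ((1 - ‖z‖) ^ α) ∧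
    ENNReal.ofReal ((1 - ‖z‖) ^ α) ≤ c2 * ENNReal.ofReal (cnorm n α * (1 - ‖z‖ ^ 2) ^ α) := by
  have hc := aux_cnorm_pos (n := n) hα
  refine ⟨ENNReal.ofReal (cnorm n α * 2 ^ |α|), ENNReal.ofReal ((cnorm n α)⁻¹ * 2 ^ |α|), ENNReal.ofReal_lt_top, ENNReal.ofReal_lt_top, ?_⟩
  intro z hz
  have hz1 := aux_ub.1 hz
  have h0 := norm_nonneg z
  obtain ⟨h1, h2⟩ := aux_rpow_two (x := 1 + ‖z‖) (α := α) (by linarith) (by linarith)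
  have e : 1 - ‖z‖ ^ 2 = (1 + ‖z‖) * (1 - ‖z‖) := by ring
  have hp : 0 < (1 - ‖z‖) ^ α := Real.rpow_pos_of_pos (by linarith) _
  rw [e, Real.mul_rpow (by linarith) (by linarith), ← ENNReal.ofReal_mul (by positivity), ← ENNReal.ofReal_mul (by positivity)]
  constructor
  · apply ENNReal.ofReal_le_ofReal
    rw [mul_assoc]
    gcongr
  · apply ENNReal.ofReal_le_ofReal
    have : (cnorm n α)⁻¹ * 2 ^ |α| * (cnorm n α * ((1 + ‖z‖) ^ α * (1 - ‖z‖) ^ α)) = (2 ^ |α| * (1 + ‖z‖) ^ α) * (1 - ‖z‖) ^ α := by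
      field_simp
    rw [this]
    nlinarith

lemma aux_W_fin {n : ℕ} {α : ℝ} (hα : -1 < α) : ∫⁻ z in uball n, ENNReal.ofReal ((1 - ‖z‖) ^ α) ∂vol n < ⊤ := by
  obtain ⟨C, hC, H⟩ := aux_hardy (n := n) hα
  have h := H (fun _ => 1) measurable_const
  have hv : vol n (uball n) < ⊤ := measure_ball_lt_top
  have h1 : ∫⁻ w in uball n, ENNReal.ofReal ((1 - ‖w‖) ^ (α + 1)) * 1 ∂vol n ≤ vol n (uball n) := by
    calc _ ≤ ∫⁻ w in uball n, 1 ∂vol n := by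
          refine setLIntegral_mono' (aux_uball_meas n) ?_
          intro w hw
          have := aux_ub.1 hw
          rw [mul_one, ENNReal.ofReal_le_one]
          exact Real.rpow_le_one (by linarith) (by linarith [norm_nonneg w]) (by linarith)
      _ = _ := by simp
  have h2 : ∫⁻ t in Set.Ioo (1 / 4 : ℝ) 1, (1 : ℝ≥0∞) = ENNReal.ofReal (3 / 4) := by
    rw [setLIntegral_const, Real.volume_Ioo, one_mul]; norm_num
  simp only [h2] at h
  rw [lintegral_mul_const' _ _ ENNReal.ofReal_ne_top] at h
  have h3 := h.trans_lt ((mul_le_mul_right h1 C).trans_lt (ENNReal.mul_lt_top hC hv))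
  by_contra hcon
  rw [not_lt, top_le_iff] at hcon
  rw [hcon, ENNReal.top_mul (by simp)] at h3
  exact lt_irrefl _ h3

lemma aux_lower {n : ℕ} {γ q α p : ℝ} (hγ : 0 < γ) (hq : 1 < q) (hα : -1 < α) (hp : 0 < p) :
    ∃ C : ℝ≥0∞, C < ⊤ ∧ ∀ f : En n → ℂ, DifferentiableOn ℂ f (uball n) →
      ∫⁻ z, ENNReal.ofReal (‖f z‖ ^ p) ∂measA n α ≤
        C * (ENNReal.ofReal ‖f 0‖ ^ p + ∫⁻ z, (areaF γ q (radArea f) z) ^ p ∂measA n α) := by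
  set η := min 1 (α + 1) / 2 with hη
  have hm0 : 0 < min 1 (α + 1) := lt_min one_pos (by linarith)
  have hη0 : 0 < η := by positivity
  have hη1 : η ≤ 1 := by have := min_le_left 1 (α + 1); rw [hη]; linarith
  have hηα : η < α + 1 := by have := min_le_right 1 (α + 1); rw [hη]; linarith
  obtain ⟨C5, hC5, H5⟩ := aux_L5 (n := n) hγ hq hα hp hη0 hη1
  obtain ⟨c1, c2, hc1, hc2, Hc⟩ := aux_dens_cmp (n := n) hα
  obtain ⟨Ch, hCh, Hh⟩ := aux_hardy (n := n) (β := α - η) (by linarith)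
  set V := ∫⁻ z in uball n, ENNReal.ofReal ((1 - ‖z‖) ^ α) ∂vol n with hV
  have hVt : V < ⊤ := aux_W_fin hα
  refine ⟨c1 * C5 * (V + Ch * c2), ENNReal.mul_lt_top (ENNReal.mul_lt_top hc1 hC5) (ENNReal.add_lt_top.2 ⟨hVt, ENNReal.mul_lt_top hCh hc2⟩), ?_⟩
  intro f hf
  obtain ⟨A, hAm, hA⟩ := aux_areaF_meas (n := n) (q := q) hγ f
  set N := ∫⁻ z, (areaF γ q (radArea f) z) ^ p ∂measA n α with hN
  set a := ENNReal.ofReal ‖f 0‖ ^ p with ha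
  set H : En n → ℝ≥0∞ := fun w => ENNReal.ofReal ((1 - ‖w‖) ^ (η - 1)) * A w ^ p with hH
  have hHm : Measurable H := by
    have : Measurable (fun w : En n => ENNReal.ofReal ((1 - ‖w‖) ^ (η - 1))) := by fun_prop
    exact this.mul (hAm.pow_const p)
  have hJ : ∫⁻ w in uball n, ENNReal.ofReal ((1 - ‖w‖) ^ (α - η + 1)) * H w ∂vol n ≤ c2 * N := by
    have : N = ∫⁻ z in uball n, ENNReal.ofReal (cnorm n α * (1 - ‖z‖ ^ 2) ^ α) * A z ^ p ∂vol n := by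
      rw [hN, aux_A_congr (k := fun z => A z ^ p) (fun z hz => by rw [hA z hz]), aux_A_int (hAm.pow_const p)]
    rw [this, ← lintegral_const_mul' _ _ hc2.ne]
    refine setLIntegral_mono' (aux_uball_meas n) ?_
    intro w hw
    have hw1 := aux_ub.1 hw
    rw [hH]
    simp only []
    rw [← mul_assoc, ← ENNReal.ofReal_mul (Real.rpow_nonneg (by linarith) _), ← Real.rpow_add (by linarith),
      show α - η + 1 + (η - 1) = α by ring, ← mul_assoc]
    gcongr
    exact (Hc w hw).2
  have hF := aux_A_congr (α := α) (h := fun z => ENNReal.ofReal (‖f z‖ ^ p)) (k := fun z => ENNReal.ofReal (‖(uball n).indicator f z‖ ^ p))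
    (fun z hz => by rw [Set.indicator_of_mem hz])
  rw [hF, aux_A_int ((aux_ind_meas hf).norm.pow_const p).ennreal_ofReal]
  calc _ ≤ ∫⁻ z in uball n, (c1 * C5) * ((a + N) * ENNReal.ofReal ((1 - ‖z‖) ^ α) + ENNReal.ofReal ((1 - ‖z‖) ^ (α - η)) *
        ∫⁻ t in Set.Ioo (1 / 4 : ℝ) 1, H ((t : ℂ) • z)) ∂vol n := by
        refine setLIntegral_mono' (aux_uball_meas n) ?_
        intro z hz
        have hz1 := aux_ub.1 hz
        rw [Set.indicator_of_mem hz, ← ENNReal.ofReal_rpow_of_nonneg (norm_nonneg _) hp.le]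
        have e : ∫⁻ t in Set.Ioo (1 / 4 : ℝ) 1, ENNReal.ofReal ((1 - t * ‖z‖) ^ (η - 1)) * A ((t : ℂ) • z) ^ p =
            ∫⁻ t in Set.Ioo (1 / 4 : ℝ) 1, H ((t : ℂ) • z) := by
          refine setLIntegral_congr_fun measurableSet_Ioo fun t ht => ?_
          rw [hH]
          simp only []
          rw [norm_smul, Complex.norm_real, Real.norm_of_nonneg (by linarith [ht.1])]
        have h5 := H5 f hf A hA z hz
        rw [e] at h5
        calc _ ≤ (c1 * ENNReal.ofReal ((1 - ‖z‖) ^ α)) * (C5 * (a + N + ENNReal.ofReal ((1 - ‖z‖) ^ (-η)) *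
              ∫⁻ t in Set.Ioo (1 / 4 : ℝ) 1, H ((t : ℂ) • z))) := mul_le_mul' (Hc z hz).1 h5
          _ = _ := by
            rw [show α - η = α + -η by ring, Real.rpow_add (by linarith), ENNReal.ofReal_mul (Real.rpow_nonneg (by linarith) _)]
            ring
    _ = (c1 * C5) * ((a + N) * V + ∫⁻ z in uball n, ENNReal.ofReal ((1 - ‖z‖) ^ (α - η)) *
        (∫⁻ t in Set.Ioo (1 / 4 : ℝ) 1, H ((t : ℂ) • z)) ∂vol n) := by
        rw [lintegral_const_mul' _ _ (ENNReal.mul_ne_top hc1.ne hC5.ne)]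
        have hm : Measurable (fun z : En n => ENNReal.ofReal ((1 - ‖z‖) ^ α)) := by fun_prop
        rw [lintegral_add_left (hm.const_mul _), lintegral_const_mul _ hm]
    _ ≤ (c1 * C5) * ((a + N) * V + Ch * (c2 * N)) := by
        gcongr
        exact (Hh H hHm).trans (by gcongr)
    _ ≤ (c1 * C5) * ((a + N) * V + Ch * (c2 * (a + N))) := by
        gcongr; exact le_add_self
    _ = _ := by ring


lemma aux_final {p : ℝ} (hp : 0 < p) {Cu C0 Cl C a N F : ℝ≥0∞} (hCu : Cu < ⊤) (hC : C < ⊤) (hC1 : 0 < C)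
    (hK1 : C0 ^ (1 / p) + Cu ^ (1 / p) ≤ C) (hK2 : Cl ^ (1 / p) * 2 ^ (1 / p) ≤ C) (ha : a < ⊤)
    (h1 : N ≤ Cu * F) (h2 : a ^ p ≤ C0 * F) (h3 : F ≤ Cl * (a ^ p + N)) :
    (F ^ (1 / p) < ⊤ ↔ N < ⊤) ∧ (C⁻¹ * (a + N ^ (1 / p)) ≤ F ^ (1 / p) ∧ F ^ (1 / p) ≤ C * (a + N ^ (1 / p))) := by
  have hp1 : 0 < 1 / p := by positivity
  have hap : (a ^ p) ^ (1 / p) = a := by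
    rw [← ENNReal.rpow_mul, mul_one_div_cancel hp.ne', ENNReal.rpow_one]
  have hN : N ^ (1 / p) ≤ Cu ^ (1 / p) * F ^ (1 / p) := by
    rw [← ENNReal.mul_rpow_of_nonneg _ _ hp1.le]; gcongr
  have ha' : a ≤ C0 ^ (1 / p) * F ^ (1 / p) := by
    rw [← ENNReal.mul_rpow_of_nonneg _ _ hp1.le, ← hap]; gcongr
  have hF : F ^ (1 / p) ≤ C * (a + N ^ (1 / p)) := by
    calc F ^ (1 / p) ≤ (Cl * (a ^ p + N)) ^ (1 / p) := by gcongr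
      _ = Cl ^ (1 / p) * (a ^ p + N) ^ (1 / p) := ENNReal.mul_rpow_of_nonneg _ _ hp1.le
      _ ≤ Cl ^ (1 / p) * (2 ^ (1 / p) * ((a ^ p) ^ (1 / p) + N ^ (1 / p))) := by
        gcongr; exact aux_add_rpow _ _ hp1.le
      _ = Cl ^ (1 / p) * 2 ^ (1 / p) * (a + N ^ (1 / p)) := by rw [hap, mul_assoc]
      _ ≤ _ := by gcongr
  refine ⟨⟨fun h => ?_, fun h => ?_⟩, ?_, hF⟩
  · refine h1.trans_lt (ENNReal.mul_lt_top hCu ?_)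
    exact (ENNReal.rpow_lt_top_iff_of_pos hp1).1 h
  · refine hF.trans_lt (ENNReal.mul_lt_top hC (ENNReal.add_lt_top.2 ⟨ha, ?_⟩))
    exact (ENNReal.rpow_lt_top_iff_of_pos hp1).2 h
  · rw [ENNReal.mul_le_iff_le_inv (by simpa using hC.ne) (by simpa using hC1.ne'), inv_inv] 
    calc a + N ^ (1 / p) ≤ C0 ^ (1 / p) * F ^ (1 / p) + Cu ^ (1 / p) * F ^ (1 / p) := by gcongr
      _ = (C0 ^ (1 / p) + Cu ^ (1 / p)) * F ^ (1 / p) := by ring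
      _ ≤ _ := by gcongr

/-- Area integral characterizations of Bergman spaces. -/
theorem stmt7 (n : ℕ) (hn : 1 ≤ n) (γ q α p : ℝ) (hγ : 0 < γ) (hq : 1 < q) (hα : -1 < α)
    (hp : 0 < p) :
    ∃ C : ℝ≥0∞, 0 < C ∧ C < ⊤ ∧
      ∀ f : En n → ℂ, DifferentiableOn ℂ f (uball n) →
        ((apnorm n p α f < ⊤ ↔
            (∫⁻ z, (areaF γ q (radArea f) z) ^ p ∂measA n α) < ⊤) ∧
         (apnorm n p α f < ⊤ ↔
            (∫⁻ z, (areaF γ q (gradArea f) z) ^ p ∂measA n α) < ⊤) ∧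
         (apnorm n p α f < ⊤ ↔
            (∫⁻ z, (areaF γ q (invGradArea f) z) ^ p ∂measA n α) < ⊤) ∧
         (C⁻¹ * (ENNReal.ofReal ‖f 0‖ +
              (∫⁻ z, (areaF γ q (radArea f) z) ^ p ∂measA n α) ^ (1 / p)) ≤ apnorm n p α f ∧
          apnorm n p α f ≤ C * (ENNReal.ofReal ‖f 0‖ +
              (∫⁻ z, (areaF γ q (radArea f) z) ^ p ∂measA n α) ^ (1 / p))) ∧
         (C⁻¹ * (ENNReal.ofReal ‖f 0‖ +
              (∫⁻ z, (areaF γ q (gradArea f) z) ^ p ∂measA n α) ^ (1 / p)) ≤ apnorm n p α f ∧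
          apnorm n p α f ≤ C * (ENNReal.ofReal ‖f 0‖ +
              (∫⁻ z, (areaF γ q (gradArea f) z) ^ p ∂measA n α) ^ (1 / p))) ∧
         (C⁻¹ * (ENNReal.ofReal ‖f 0‖ +
              (∫⁻ z, (areaF γ q (invGradArea f) z) ^ p ∂measA n α) ^ (1 / p)) ≤ apnorm n p α f ∧
          apnorm n p α f ≤ C * (ENNReal.ofReal ‖f 0‖ +
              (∫⁻ z, (areaF γ q (invGradArea f) z) ^ p ∂measA n α) ^ (1 / p)))) := by
  obtain ⟨Cu, hCu, Hu⟩ := aux_upper (n := n) hγ hq hα hp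
  obtain ⟨C0, hC0, H0⟩ := aux_f0 (n := n) hα hp
  obtain ⟨Cl, hCl, Hl⟩ := aux_lower (n := n) hγ hq hα hp
  have hp1 : 0 ≤ 1 / p := by positivity
  have hft : ∀ x : ℝ≥0∞, x < ⊤ → x ^ (1 / p) < ⊤ := fun x hx => ENNReal.rpow_lt_top_of_nonneg hp1 hx.ne
  set C : ℝ≥0∞ := (C0 ^ (1 / p) + Cu ^ (1 / p)) + Cl ^ (1 / p) * 2 ^ (1 / p) + 1 with hC
  have hCt : C < ⊤ := by
    refine ENNReal.add_lt_top.2 ⟨ENNReal.add_lt_top.2 ⟨ENNReal.add_lt_top.2 ⟨hft _ hC0, hft _ hCu⟩, ?_⟩, by simp⟩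
    exact ENNReal.mul_lt_top (hft _ hCl) (hft _ (by simp))
  have hC1 : 0 < C := lt_of_lt_of_le one_pos le_add_self
  have hK1 : C0 ^ (1 / p) + Cu ^ (1 / p) ≤ C := le_self_add.trans le_self_add
  have hK2 : Cl ^ (1 / p) * 2 ^ (1 / p) ≤ C := le_add_self.trans le_self_add
  refine ⟨C, hC1, hCt, ?_⟩
  intro f hf
  have hRG : ∫⁻ z, (areaF γ q (radArea f) z) ^ p ∂measA n α ≤ ∫⁻ z, (areaF γ q (gradArea f) z) ^ p ∂measA n α :=
    aux_A_mono fun z hz => ENNReal.rpow_le_rpow (aux_areaF_mono hγ hq (fun w hw => aux_rad_le hw) hz) hp.le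
  have hGI : ∫⁻ z, (areaF γ q (gradArea f) z) ^ p ∂measA n α ≤ ∫⁻ z, (areaF γ q (invGradArea f) z) ^ p ∂measA n α :=
    aux_A_mono fun z hz => ENNReal.rpow_le_rpow (aux_areaF_mono hγ hq (fun w hw => aux_grad_le hf hw) hz) hp.le
  have hI := Hu f hf
  have h0 := H0 f hf
  have hl := Hl f hf
  have hR := aux_final hp hCu hCt hC1 hK1 hK2 ENNReal.ofReal_lt_top (hRG.trans (hGI.trans hI)) h0 hl
  have hG := aux_final hp hCu hCt hC1 hK1 hK2 ENNReal.ofReal_lt_top (hGI.trans hI) h0 (hl.trans (by gcongr))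
  have hII := aux_final hp hCu hCt hC1 hK1 hK2 ENNReal.ofReal_lt_top hI h0
    (hl.trans (mul_le_mul_right (add_le_add_right (hRG.trans hGI) _) _))
  unfold apnorm
  exact ⟨hR.1, hG.1, hII.1, hR.2, hG.2, hII.2⟩
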